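/- arXiv:2601.13586 — 3 statements merged into one kernel-verified Lean document; each statement's English description precedes it below -/
import Mathlib

section
/- Assume h₁/μ₁ ≥ h₂/μ₂. Then for every (i,k,ℓ) ∈ X̃_diff with ℓ ≥ C₂: (i) if h₀ ≥ h₂ and D(i,k,ℓ) ≥ 0, then D(i,k,ℓ) ≤ (i − y_k)·c′ + b′; (ii) if h₀ ≤ h₂, then D(i,k,ℓ) ≥ (i − y_k)·c′ + b′. Consequently, if h₀ = h₂ and D(i,k,ℓ) ≥ 0, then D(i,k,ℓ) = (i − y_k)·c′ + b′. -/
/-- Overall service rate `d(k,ℓ) = k·μ₁ + min(ℓ,C₂)·μ₂`. -/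
noncomputable def dRate (C₂ : ℕ) (μ₁ μ₂ : ℝ) (k ℓ : ℕ) : ℝ :=
  (k : ℝ) * μ₁ + ((min ℓ C₂ : ℕ) : ℝ) * μ₂

/-- Membership of `(i,k,ℓ)` in the state space `X`. -/
def memX (C₁ : ℕ) (i k ℓ : ℕ) : Prop :=
  (i = 0 ∧ k + ℓ < C₁) ∨ k + ℓ = C₁

/-- `v` satisfies the optimality (Bellman) equations of the clearing system.
Terms whose coefficient `k·μ₁` or `min(ℓ,C₂)·μ₂` vanishes contribute `0`,
matching the convention that such summands are omitted. -/
def IsValue (C₁ C₂ : ℕ) (μ₁ μ₂ h₀ h₁ h₂ : ℝ) (v : ℕ → ℕ → ℕ → ℝ) : Prop :=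
  v 0 0 0 = 0 ∧
  (∀ k ℓ : ℕ, k + ℓ ≤ C₁ → ¬(k = 0 ∧ ℓ = 0) →
    v 0 k ℓ = ((k : ℝ) * h₁ + (ℓ : ℝ) * h₂) / dRate C₂ μ₁ μ₂ k ℓ
      + ((k : ℝ) * μ₁ / dRate C₂ μ₁ μ₂ k ℓ) * v 0 (k - 1) ℓ
      + (((min ℓ C₂ : ℕ) : ℝ) * μ₂ / dRate C₂ μ₁ μ₂ k ℓ) * v 0 k (ℓ - 1)) ∧
  (∀ i k ℓ : ℕ, k + ℓ = C₁ →
    v (i + 1) k ℓ =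
      (((i : ℝ) + 1) * h₀ + (k : ℝ) * h₁ + (ℓ : ℝ) * h₂) / dRate C₂ μ₁ μ₂ k ℓ
      + ((k : ℝ) * μ₁ / dRate C₂ μ₁ μ₂ k ℓ) *
          min (v i k ℓ) (v i (k - 1) (ℓ + 1))
      + (((min ℓ C₂ : ℕ) : ℝ) * μ₂ / dRate C₂ μ₁ μ₂ k ℓ) *
          min (v i (k + 1) (ℓ - 1)) (v i k ℓ))

/-- The difference `D(i,k,ℓ) = v(i,k,ℓ) − v(i,k−1,ℓ+1)`. -/
noncomputable def Dv (v : ℕ → ℕ → ℕ → ℝ) (i k ℓ : ℕ) : ℝ :=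
  v i k ℓ - v i (k - 1) (ℓ + 1)

theorem aux_min_sub (x y z : ℝ) : min x y - min y z = min (x - y) 0 + max (y - z) 0 := by
  rcases le_total x y with h | h <;> rcases le_total y z with h' | h' <;>
    simp [h, h']

/-- Closed form of the value function in the clearing phase. -/
theorem aux_base (C₁ C₂ : ℕ) (hC₂pos : 1 ≤ C₂) (μ₁ μ₂ h₀ h₁ h₂ : ℝ)
    (hμ₁ : 0 < μ₁) (hμ₂ : 0 < μ₂)
    (v : ℕ → ℕ → ℕ → ℝ) (hv : IsValue C₁ C₂ μ₁ μ₂ h₀ h₁ h₂ v) :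
    ∀ n k ℓ : ℕ, k + ℓ = n → n ≤ C₁ → v 0 k ℓ = k * (h₁ / μ₁) +
      ∑ j ∈ Finset.range ℓ, h₂ * ((j : ℝ) + 1) / (((min (j + 1) C₂ : ℕ) : ℝ) * μ₂) := by
  obtain ⟨hz, hb, -⟩ := hv
  intro n
  induction n with
  | zero =>
    intro k ℓ h _
    obtain ⟨rfl, rfl⟩ : k = 0 ∧ ℓ = 0 := by omega
    simp [hz]
  | succ n ih =>
    intro k ℓ h hn
    rw [hb k ℓ (by omega) (by omega)]
    rcases k with _ | k
    · obtain rfl : ℓ = n + 1 := by omega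
      have hM : 0 < ((min (n + 1) C₂ : ℕ) : ℝ) := by
        have : 0 < min (n + 1) C₂ := by omega
        exact_mod_cast this
      have e := ih 0 n (by omega) (by omega)
      simp only [Nat.add_sub_cancel, e, Finset.sum_range_succ, dRate]
      generalize ((min (n + 1) C₂ : ℕ) : ℝ) = M at *
      push_cast
      field_simp
      ring
    · have e1 := ih k ℓ (by omega) (by omega)
      rcases ℓ with _ | l
      · simp only [Nat.add_sub_cancel, e1, dRate]
        have : (0 : ℝ) < (k : ℝ) + 1 := by positivity
        simp
        field_simp
        ring
      · have e2 := ih (k + 1) l (by omega) (by omega)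
        have hM : 0 < ((min (l + 1) C₂ : ℕ) : ℝ) := by
          have : 0 < min (l + 1) C₂ := by omega
          exact_mod_cast this
        simp only [Nat.add_sub_cancel, e1, e2, Finset.sum_range_succ, dRate]
        generalize ((min (l + 1) C₂ : ℕ) : ℝ) = M at *
        generalize ∑ j ∈ Finset.range l,
          h₂ * ((j : ℝ) + 1) / (((min (j + 1) C₂ : ℕ) : ℝ) * μ₂) = S
        push_cast
        have : (0 : ℝ) < (k : ℝ) + 1 := by positivity
        have : (0 : ℝ) < ((k : ℝ) + 1) * μ₁ + M * μ₂ := by positivity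
        field_simp
        ring

theorem aux_base_D (C₁ C₂ : ℕ) (hC₂pos : 1 ≤ C₂) (μ₁ μ₂ h₀ h₁ h₂ : ℝ)
    (hμ₁ : 0 < μ₁) (hμ₂ : 0 < μ₂)
    (v : ℕ → ℕ → ℕ → ℝ) (hv : IsValue C₁ C₂ μ₁ μ₂ h₀ h₁ h₂ v) (p ℓ : ℕ) (h : p + 1 + ℓ = C₁) :
    v 0 (p + 1) ℓ - v 0 p (ℓ + 1) =
      h₁ / μ₁ - h₂ * ((ℓ : ℝ) + 1) / (((min (ℓ + 1) C₂ : ℕ) : ℝ) * μ₂) := by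
  rw [aux_base C₁ C₂ hC₂pos μ₁ μ₂ h₀ h₁ h₂ hμ₁ hμ₂ v hv C₁ (p + 1) ℓ h le_rfl,
    aux_base C₁ C₂ hC₂pos μ₁ μ₂ h₀ h₁ h₂ hμ₁ hμ₂ v hv C₁ p (ℓ + 1) (by omega) le_rfl,
    Finset.sum_range_succ]
  push_cast
  ring

/-- Multiplied-out Bellman equations for two neighbouring states. -/
theorem aux_rec (C₁ C₂ : ℕ) (hC₂pos : 1 ≤ C₂) (μ₁ μ₂ h₀ h₁ h₂ : ℝ)
    (hμ₁ : 0 < μ₁) (hμ₂ : 0 < μ₂)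
    (v : ℕ → ℕ → ℕ → ℝ) (hv : IsValue C₁ C₂ μ₁ μ₂ h₀ h₁ h₂ v) (i p ℓ : ℕ)
    (h : p + 1 + ℓ = C₁) (M N Δ₁ Δ₂ : ℝ)
    (hM : M = ((min ℓ C₂ : ℕ) : ℝ) * μ₂) (hN : N = ((min (ℓ + 1) C₂ : ℕ) : ℝ) * μ₂)
    (hΔ₁ : Δ₁ = min (v i (p + 1) ℓ - v i p (ℓ + 1)) 0
      + max (v i p (ℓ + 1) - v i (p - 1) (ℓ + 2)) 0)
    (hΔ₂ : Δ₂ = min (v i (p + 2) (ℓ - 1) - v i (p + 1) ℓ) 0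
      + max (v i (p + 1) ℓ - v i p (ℓ + 1)) 0) :
    (p * μ₁ + N) * (((p : ℝ) + 1) * μ₁ + M) * (v (i + 1) (p + 1) ℓ - v (i + 1) p (ℓ + 1)) =
      p * μ₁ * (((p : ℝ) + 1) * μ₁ + M) * Δ₁ + M * (p * μ₁ + N) * Δ₂
      + (p * μ₁ + N) * (((i : ℝ) + 1) * h₀ + (p + 1) * h₁ + ℓ * h₂)
      - (((p : ℝ) + 1) * μ₁ + M) * (((i : ℝ) + 1) * h₀ + p * h₁ + (ℓ + 1) * h₂) := by
  rw [← aux_min_sub] at hΔ₁ hΔ₂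
  have hM0 : 0 ≤ M := by rw [hM]; positivity
  have hN0 : 0 < N := by
    have : 0 < min (ℓ + 1) C₂ := by omega
    have : 0 < ((min (ℓ + 1) C₂ : ℕ) : ℝ) := by exact_mod_cast this
    rw [hN]; positivity
  have e1 := hv.2.2 i (p + 1) ℓ h
  have e2 := hv.2.2 i p (ℓ + 1) (by omega)
  simp only [dRate, Nat.add_sub_cancel, add_assoc, Nat.reduceAdd, ← hM, ← hN] at e1 e2
  have hd1 : (0 : ℝ) < ((p : ℝ) + 1) * μ₁ + M := by positivity
  have hd2 : (0 : ℝ) < (p : ℝ) * μ₁ + N := by positivity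
  push_cast at e1 e2
  rw [e1, e2, hΔ₁, hΔ₂]
  generalize min (v i (p + 1) ℓ) (v i p (ℓ + 1)) = a
  generalize min (v i p (ℓ + 1)) (v i (p - 1) (ℓ + 2)) = b
  generalize min (v i (p + 2) (ℓ - 1)) (v i (p + 1) ℓ) = c
  have hn1 := hd1.ne'
  have hn2 := hd2.ne'
  field_simp
  ring

/-- Lower bound on the differences in the region where pool 2 has a free server. -/
theorem aux_low (C₁ C₂ : ℕ) (hC₂pos : 1 ≤ C₂) (hC : C₂ < C₁) (μ₁ μ₂ h₀ h₁ h₂ : ℝ)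
    (hμ₁ : 0 < μ₁) (hμ₂ : 0 < μ₂) (hh₀ : 0 < h₀)
    (v : ℕ → ℕ → ℕ → ℝ) (hv : IsValue C₁ C₂ μ₁ μ₂ h₀ h₁ h₂ v)
    (hcost : h₂ / μ₂ ≤ h₁ / μ₁) (i : ℕ) :
    ∀ p ℓ : ℕ, p + 1 + ℓ = C₁ → ℓ + 1 ≤ C₂ →
      min 0 (h₁ / μ₁ - h₂ / μ₂ - h₀ / (C₂ * μ₂) * ((i : ℝ) + 1)) ≤
        v i (p + 1) ℓ - v i p (ℓ + 1) := by
  have hC₂r : (0 : ℝ) < C₂ := by exact_mod_cast hC₂pos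
  induction i with
  | zero =>
    intro p ℓ h hl
    rw [aux_base_D C₁ C₂ hC₂pos μ₁ μ₂ h₀ h₁ h₂ hμ₁ hμ₂ v hv p ℓ h, min_eq_left hl]
    apply min_le_of_left_le
    have : h₂ * ((ℓ : ℝ) + 1) / (((ℓ + 1 : ℕ) : ℝ) * μ₂) = h₂ / μ₂ := by
      push_cast
      have : (0 : ℝ) < (ℓ : ℝ) + 1 := by positivity
      field_simp
    rw [this]; linarith
  | succ i ih =>
    intro p ℓ h hl
    set g := h₁ / μ₁ - h₂ / μ₂ - h₀ / (C₂ * μ₂) * ((i : ℝ) + 1) with hg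
    have hr := aux_rec C₁ C₂ hC₂pos μ₁ μ₂ h₀ h₁ h₂ hμ₁ hμ₂ v hv i p ℓ h
      (ℓ * μ₂) ((ℓ + 1) * μ₂) _ _ (by rw [min_eq_left (by omega)])
      (by rw [min_eq_left hl]; push_cast; ring) rfl rfl
    have hD := ih p ℓ h hl
    set w := min 0 g with hw
    have hw0 : w ≤ 0 := min_le_left _ _
    have hwg : w ≤ g := min_le_right _ _
    have hΔ1 : w ≤ min (v i (p + 1) ℓ - v i p (ℓ + 1)) 0
        + max (v i p (ℓ + 1) - v i (p - 1) (ℓ + 2)) 0 := by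
      have := le_max_right (v i p (ℓ + 1) - v i (p - 1) (ℓ + 2)) 0
      have := le_min hD hw0
      linarith
    have hΔ2 : ℓ * w ≤ ℓ * (min (v i (p + 2) (ℓ - 1) - v i (p + 1) ℓ) 0
      + max (v i (p + 1) ℓ - v i p (ℓ + 1)) 0) := by
      rcases ℓ with _ | l
      · simp
      · have h3 := ih (p + 1) l (by omega) (by omega)
        have := le_max_right (v i (p + 1) (l + 1) - v i p (l + 1 + 1)) 0
        have := le_min h3 hw0
        apply mul_le_mul_of_nonneg_left _ (by positivity)
        simp only [Nat.add_sub_cancel]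
        linarith
    generalize min (v i (p + 1) ℓ - v i p (ℓ + 1)) 0
        + max (v i p (ℓ + 1) - v i (p - 1) (ℓ + 2)) 0 = Δ₁ at *
    generalize min (v i (p + 2) (ℓ - 1) - v i (p + 1) ℓ) 0
      + max (v i (p + 1) ℓ - v i p (ℓ + 1)) 0 = Δ₂ at *
    generalize v (i + 1) (p + 1) ℓ - v (i + 1) p (ℓ + 1) = D at *
    have hgoal : w ≤ D := by
      have hCr : (C₁ : ℝ) = p + 1 + ℓ := by rw [← h]; push_cast; ring
      have hCC : (C₂ : ℝ) ≤ p + 1 + ℓ := by rw [← hCr]; exact_mod_cast hC.le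
      have hP : 0 < (p * μ₁ + (ℓ + 1) * μ₂) * (((p : ℝ) + 1) * μ₁ + ℓ * μ₂) := by positivity
      refine le_of_mul_le_mul_left ?_ hP
      have k1 : (p * μ₁ * (((p : ℝ) + 1) * μ₁ + ℓ * μ₂)) * w ≤
          (p * μ₁ * (((p : ℝ) + 1) * μ₁ + ℓ * μ₂)) * Δ₁ :=
        mul_le_mul_of_nonneg_left hΔ1 (by positivity)
      have k2 : (μ₂ * (p * μ₁ + (ℓ + 1) * μ₂)) * (ℓ * w) ≤
          (μ₂ * (p * μ₁ + (ℓ + 1) * μ₂)) * (ℓ * Δ₂) :=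
        mul_le_mul_of_nonneg_left hΔ2 (by positivity)
      have k3 : ((p : ℝ) + 1 + ℓ) * μ₁ * μ₂ * w ≤ ((p : ℝ) + 1 + ℓ) * μ₁ * μ₂ * g :=
        mul_le_mul_of_nonneg_left hwg (by positivity)
      have k4 : ((p : ℝ) + 1 + ℓ) * μ₁ * μ₂ * g = ((p : ℝ) + 1 + ℓ) * (h₁ * μ₂ - h₂ * μ₁)
          - (((p : ℝ) + 1 + ℓ) / C₂) * (μ₁ * h₀ * (i + 1)) := by
        rw [hg]; field_simp
      have k5 : 1 ≤ ((p : ℝ) + 1 + ℓ) / C₂ := by rw [le_div_iff₀ hC₂r]; linarith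
      have k6 : 1 * (μ₁ * h₀ * ((i : ℝ) + 1)) ≤
          (((p : ℝ) + 1 + ℓ) / C₂) * (μ₁ * h₀ * (i + 1)) :=
        mul_le_mul_of_nonneg_right k5 (by positivity)
      have k7 : 0 ≤ μ₂ * h₀ * ((i : ℝ) + 1) := by positivity
      linarith
    refine le_trans (le_min (min_le_left _ _) ?_) hgoal
    · refine (min_le_right _ _).trans ?_
      rw [hg]
      have : 0 < h₀ / (C₂ * μ₂) := by positivity
      push_cast
      linarith

/-- The affine bound, in terms of `p = k - 1`. -/
noncomputable def auxF (C₁ C₂ : ℕ) (μ₁ μ₂ h₀ h₁ h₂ : ℝ) (i p : ℕ) : ℝ :=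
  ((i : ℝ) - ((p : ℝ) + (C₂ : ℝ) * (μ₂ / μ₁))) * (-h₀ / ((C₂ : ℝ) * μ₂))
    + ((h₁ - h₂) / μ₁ - (C₁ : ℝ) * h₂ / ((C₂ : ℝ) * μ₂))

theorem aux_base_F (C₁ C₂ : ℕ) (hC₂pos : 1 ≤ C₂) (μ₁ μ₂ h₀ h₁ h₂ : ℝ)
    (hμ₁ : 0 < μ₁) (hμ₂ : 0 < μ₂)
    (v : ℕ → ℕ → ℕ → ℝ) (hv : IsValue C₁ C₂ μ₁ μ₂ h₀ h₁ h₂ v) (p ℓ : ℕ) (h : p + 1 + ℓ = C₁)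
    (hl : C₂ ≤ ℓ) :
    v 0 (p + 1) ℓ - v 0 p (ℓ + 1) = auxF C₁ C₂ μ₁ μ₂ h₀ h₁ h₂ 0 p
      - (h₀ - h₂) * (((p : ℝ) + (C₂ : ℝ) * (μ₂ / μ₁)) / (C₂ * μ₂)) := by
  have hC₂r : (0 : ℝ) < C₂ := by exact_mod_cast hC₂pos
  have hCr : (C₁ : ℝ) = p + 1 + ℓ := by rw [← h]; push_cast; ring
  rw [aux_base_D C₁ C₂ hC₂pos μ₁ μ₂ h₀ h₁ h₂ hμ₁ hμ₂ v hv p ℓ h, min_eq_right (by omega), auxF, hCr]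
  push_cast
  field_simp
  ring

theorem aux_rec_F (C₁ C₂ : ℕ) (hC₂pos : 1 ≤ C₂) (μ₁ μ₂ h₀ h₁ h₂ : ℝ)
    (hμ₁ : 0 < μ₁) (hμ₂ : 0 < μ₂)
    (v : ℕ → ℕ → ℕ → ℝ) (hv : IsValue C₁ C₂ μ₁ μ₂ h₀ h₁ h₂ v) (i p ℓ : ℕ)
    (h : p + 1 + ℓ = C₁) (hl : C₂ ≤ ℓ) (b Δ₁ Δ₂ : ℝ)
    (hb : b = C₂ * μ₂)
    (hΔ₁ : Δ₁ = min (v i (p + 1) ℓ - v i p (ℓ + 1)) 0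
      + max (v i p (ℓ + 1) - v i (p - 1) (ℓ + 2)) 0)
    (hΔ₂ : Δ₂ = min (v i (p + 2) (ℓ - 1) - v i (p + 1) ℓ) 0
      + max (v i (p + 1) ℓ - v i p (ℓ + 1)) 0) :
    (p * μ₁ + b) * (((p : ℝ) + 1) * μ₁ + b) * (v (i + 1) (p + 1) ℓ - v (i + 1) p (ℓ + 1)) =
      p * μ₁ * (((p : ℝ) + 1) * μ₁ + b) * Δ₁ + b * (p * μ₁ + b) * Δ₂
      + b * μ₁ * auxF C₁ C₂ μ₁ μ₂ h₀ h₁ h₂ (i + 1) p - h₀ * (p * μ₁ + b) := by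
  have hC₂r : (0 : ℝ) < C₂ := by exact_mod_cast hC₂pos
  have hCr : (C₁ : ℝ) = p + 1 + ℓ := by rw [← h]; push_cast; ring
  rw [aux_rec C₁ C₂ hC₂pos μ₁ μ₂ h₀ h₁ h₂ hμ₁ hμ₂ v hv i p ℓ h b b Δ₁ Δ₂
    (by rw [min_eq_right hl, hb]) (by rw [min_eq_right (by omega), hb]) hΔ₁ hΔ₂, auxF, hCr, hb]
  push_cast
  field_simp
  ring

theorem auxF_step (C₁ C₂ : ℕ) (μ₁ μ₂ h₀ h₁ h₂ : ℝ) (i p : ℕ) :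
    auxF C₁ C₂ μ₁ μ₂ h₀ h₁ h₂ (i + 1) (p + 1) = auxF C₁ C₂ μ₁ μ₂ h₀ h₁ h₂ i p := by
  simp only [auxF]; push_cast; ring

theorem auxF_step' (C₁ C₂ : ℕ) (hC₂pos : 1 ≤ C₂) (μ₁ μ₂ h₀ h₁ h₂ : ℝ) (hμ₂ : 0 < μ₂) (i p : ℕ) :
    C₂ * μ₂ * auxF C₁ C₂ μ₁ μ₂ h₀ h₁ h₂ i p =
      C₂ * μ₂ * auxF C₁ C₂ μ₁ μ₂ h₀ h₁ h₂ (i + 1) p + h₀ := by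
  have hC₂r : (0 : ℝ) < C₂ := by exact_mod_cast hC₂pos
  simp only [auxF]; push_cast; field_simp; ring

theorem aux_upper (C₁ C₂ : ℕ) (hC₂pos : 1 ≤ C₂) (μ₁ μ₂ h₀ h₁ h₂ : ℝ)
    (hμ₁ : 0 < μ₁) (hμ₂ : 0 < μ₂) (hh₀ : 0 < h₀)
    (v : ℕ → ℕ → ℕ → ℝ) (hv : IsValue C₁ C₂ μ₁ μ₂ h₀ h₁ h₂ v)
    (hle : h₂ ≤ h₀) (i : ℕ) :
    ∀ p ℓ : ℕ, p + 1 + ℓ = C₁ → C₂ ≤ ℓ → 0 ≤ v i (p + 1) ℓ - v i p (ℓ + 1) →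
      v i (p + 1) ℓ - v i p (ℓ + 1) ≤ auxF C₁ C₂ μ₁ μ₂ h₀ h₁ h₂ i p := by
  have hC₂r : (0 : ℝ) < C₂ := by exact_mod_cast hC₂pos
  induction i with
  | zero =>
    intro p ℓ h hl _
    rw [aux_base_F C₁ C₂ hC₂pos μ₁ μ₂ h₀ h₁ h₂ hμ₁ hμ₂ v hv p ℓ h hl]
    have : 0 ≤ (h₀ - h₂) * (((p : ℝ) + (C₂ : ℝ) * (μ₂ / μ₁)) / (C₂ * μ₂)) :=
      mul_nonneg (by linarith) (by positivity)
    linarith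
  | succ i ih =>
    intro p ℓ h hl hpos
    have hr := aux_rec_F C₁ C₂ hC₂pos μ₁ μ₂ h₀ h₁ h₂ hμ₁ hμ₂ v hv i p ℓ h hl _ _ _ rfl rfl rfl
    have hF := auxF_step' C₁ C₂ hC₂pos μ₁ μ₂ h₀ h₁ h₂ hμ₂ i p
    have hb : 0 < (C₂ : ℝ) * μ₂ := by positivity
    have hD1 : max (v i (p + 1) ℓ - v i p (ℓ + 1)) 0 ≤
        max (auxF C₁ C₂ μ₁ μ₂ h₀ h₁ h₂ i p) 0 := by
      rcases le_total 0 (v i (p + 1) ℓ - v i p (ℓ + 1)) with h' | h'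
      · exact max_le_max (ih p ℓ h hl h') le_rfl
      · rw [max_eq_right h']; exact le_max_right _ _
    have hΔ2 : min (v i (p + 2) (ℓ - 1) - v i (p + 1) ℓ) 0
        + max (v i (p + 1) ℓ - v i p (ℓ + 1)) 0 ≤ max (auxF C₁ C₂ μ₁ μ₂ h₀ h₁ h₂ i p) 0 := by
      have := min_le_right (v i (p + 2) (ℓ - 1) - v i (p + 1) ℓ) 0
      linarith
    have hΔ1 : (p : ℝ) * (min (v i (p + 1) ℓ - v i p (ℓ + 1)) 0
        + max (v i p (ℓ + 1) - v i (p - 1) (ℓ + 2)) 0) ≤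
        p * max (auxF C₁ C₂ μ₁ μ₂ h₀ h₁ h₂ (i + 1) p) 0 := by
      rcases p with _ | p
      · simp
      · apply mul_le_mul_of_nonneg_left _ (by positivity)
        have := min_le_right (v i (p + 1 + 1) ℓ - v i (p + 1) (ℓ + 1)) 0
        rw [auxF_step]
        have : max (v i (p + 1) (ℓ + 1) - v i p (ℓ + 2)) 0 ≤
            max (auxF C₁ C₂ μ₁ μ₂ h₀ h₁ h₂ i p) 0 := by
          rcases le_total 0 (v i (p + 1) (ℓ + 1) - v i p (ℓ + 2)) with h' | h'
          · exact max_le_max (ih p (ℓ + 1) (by omega) (by omega) h') le_rfl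
          · rw [max_eq_right h']; exact le_max_right _ _
        simp only [Nat.add_sub_cancel]
        linarith
    generalize min (v i (p + 1) ℓ - v i p (ℓ + 1)) 0
        + max (v i p (ℓ + 1) - v i (p - 1) (ℓ + 2)) 0 = Δ₁ at *
    generalize min (v i (p + 2) (ℓ - 1) - v i (p + 1) ℓ) 0
      + max (v i (p + 1) ℓ - v i p (ℓ + 1)) 0 = Δ₂ at *
    generalize v (i + 1) (p + 1) ℓ - v (i + 1) p (ℓ + 1) = D at *
    generalize auxF C₁ C₂ μ₁ μ₂ h₀ h₁ h₂ i p = Fp at *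
    generalize auxF C₁ C₂ μ₁ μ₂ h₀ h₁ h₂ (i + 1) p = Fm at *
    generalize (C₂ : ℝ) * μ₂ = b at *
    clear hD1 ih hv
    have hp : (0 : ℝ) ≤ p := by positivity
    generalize (p : ℝ) = q at *
    have hA : 0 < q * μ₁ + b := by positivity
    have hA' : 0 < (q + 1) * μ₁ + b := by positivity
    have k1 : μ₁ * ((q + 1) * μ₁ + b) * (q * Δ₁) ≤ μ₁ * ((q + 1) * μ₁ + b) * (q * max Fm 0) :=
      mul_le_mul_of_nonneg_left hΔ1 (by positivity)
    have k2 : b * (q * μ₁ + b) * Δ₂ ≤ b * (q * μ₁ + b) * max Fp 0 :=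
      mul_le_mul_of_nonneg_left hΔ2 (by positivity)
    have k0 : 0 ≤ (q * μ₁ + b) * ((q + 1) * μ₁ + b) * D := by positivity
    have kA : (q * μ₁ + b) * (b * Fp) = (q * μ₁ + b) * (b * Fm + h₀) := by rw [hF]
    have hFm : 0 ≤ Fm := by
      by_contra hneg
      push Not at hneg
      rw [max_eq_right hneg.le] at k1
      rcases le_total 0 Fp with hp' | hp'
      · rw [max_eq_left hp'] at k2
        have : (b * ((q + 1) * μ₁ + b)) * Fm < 0 := mul_neg_of_pos_of_neg (by positivity) hneg
        linarith
      · rw [max_eq_right hp'] at k2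
        have : (b * μ₁) * Fm < 0 := mul_neg_of_pos_of_neg (by positivity) hneg
        have : 0 < h₀ * (q * μ₁ + b) := by positivity
        linarith
    have hFp : 0 ≤ Fp := by
      have : 0 ≤ b * Fp := by rw [hF]; positivity
      exact nonneg_of_mul_nonneg_right this hb
    rw [max_eq_left hFm] at k1
    rw [max_eq_left hFp] at k2
    have hP : 0 < (q * μ₁ + b) * ((q + 1) * μ₁ + b) := by positivity
    refine le_of_mul_le_mul_left ?_ hP
    linarith

theorem aux_lower (C₁ C₂ : ℕ) (hC₂pos : 1 ≤ C₂) (hC : C₂ < C₁) (μ₁ μ₂ h₀ h₁ h₂ : ℝ)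
    (hμ₁ : 0 < μ₁) (hμ₂ : 0 < μ₂) (hh₀ : 0 < h₀)
    (v : ℕ → ℕ → ℕ → ℝ) (hv : IsValue C₁ C₂ μ₁ μ₂ h₀ h₁ h₂ v)
    (hcost : h₂ / μ₂ ≤ h₁ / μ₁)
    (hle : h₀ ≤ h₂) (i : ℕ) :
    ∀ p ℓ : ℕ, p + 1 + ℓ = C₁ → C₂ ≤ ℓ →
      auxF C₁ C₂ μ₁ μ₂ h₀ h₁ h₂ i p ≤ v i (p + 1) ℓ - v i p (ℓ + 1) := by
  have hC₂r : (0 : ℝ) < C₂ := by exact_mod_cast hC₂pos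
  induction i with
  | zero =>
    intro p ℓ h hl
    rw [aux_base_F C₁ C₂ hC₂pos μ₁ μ₂ h₀ h₁ h₂ hμ₁ hμ₂ v hv p ℓ h hl]
    have : 0 ≤ (h₂ - h₀) * (((p : ℝ) + (C₂ : ℝ) * (μ₂ / μ₁)) / (C₂ * μ₂)) :=
      mul_nonneg (by linarith) (by positivity)
    linarith
  | succ i ih =>
    intro p ℓ h hl
    have hr := aux_rec_F C₁ C₂ hC₂pos μ₁ μ₂ h₀ h₁ h₂ hμ₁ hμ₂ v hv i p ℓ h hl _ _ _ rfl rfl rfl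
    have hF := auxF_step' C₁ C₂ hC₂pos μ₁ μ₂ h₀ h₁ h₂ hμ₂ i p
    have hb : 0 < (C₂ : ℝ) * μ₂ := by positivity
    have hmono : ∀ j q, auxF C₁ C₂ μ₁ μ₂ h₀ h₁ h₂ (j + 1) q ≤ auxF C₁ C₂ μ₁ μ₂ h₀ h₁ h₂ j q := by
      intro j q
      have := auxF_step' C₁ C₂ hC₂pos μ₁ μ₂ h₀ h₁ h₂ hμ₂ j q
      refine le_of_mul_le_mul_left ?_ hb
      linarith
    have hD := ih p ℓ h hl
    have hΔ2 : auxF C₁ C₂ μ₁ μ₂ h₀ h₁ h₂ i p ≤ min (v i (p + 2) (ℓ - 1) - v i (p + 1) ℓ) 0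
        + max (v i (p + 1) ℓ - v i p (ℓ + 1)) 0 := by
      have hmx := le_max_left (v i (p + 1) ℓ - v i p (ℓ + 1)) 0
      have hmx0 := le_max_right (v i (p + 1) ℓ - v i p (ℓ + 1)) 0
      rcases le_total 0 (v i (p + 2) (ℓ - 1) - v i (p + 1) ℓ) with h' | h'
      · rw [min_eq_right h']; linarith
      rw [min_eq_left h']
      obtain ⟨l, rfl⟩ : ∃ l, ℓ = l + 1 := ⟨ℓ - 1, by omega⟩
      simp only [Nat.add_sub_cancel] at h' ⊢
      rcases Nat.lt_or_ge l C₂ with hlt | hge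
      · have hlC : C₂ = l + 1 := by omega
        have hlow := aux_low C₁ C₂ hC₂pos hC μ₁ μ₂ h₀ h₁ h₂ hμ₁ hμ₂ hh₀ v hv hcost i (p + 1) l
          (by omega) (by omega)
        have hFG : auxF C₁ C₂ μ₁ μ₂ h₀ h₁ h₂ i p =
            h₁ / μ₁ - h₂ / μ₂ - h₀ / (C₂ * μ₂) * ((i : ℝ) + 1)
              - (h₂ - h₀) * ((p + 1) / (C₂ * μ₂) + 1 / μ₁) := by
          have hCr : (C₁ : ℝ) = p + 1 + C₂ := by rw [← h, hlC]; push_cast; ring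
          rw [auxF, hCr]
          field_simp
          ring
        have : 0 ≤ (h₂ - h₀) * (((p : ℝ) + 1) / (C₂ * μ₂) + 1 / μ₁) :=
          mul_nonneg (by linarith) (by positivity)
        rcases min_le_iff.1 hlow with h3 | h3
        · change 0 ≤ v i (p + 2) l - v i (p + 1) (l + 1) at h3
          linarith
        · change _ ≤ v i (p + 2) l - v i (p + 1) (l + 1) at h3
          linarith
      · have h3 := ih (p + 1) l (by omega) hge
        have h4 := hmono i (p + 1)
        rw [auxF_step] at h4
        change _ ≤ v i (p + 2) l - v i (p + 1) (l + 1) at h3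
        linarith
    have hΔ1 : p * auxF C₁ C₂ μ₁ μ₂ h₀ h₁ h₂ (i + 1) p ≤
        (p : ℝ) * (min (v i (p + 1) ℓ - v i p (ℓ + 1)) 0
        + max (v i p (ℓ + 1) - v i (p - 1) (ℓ + 2)) 0) := by
      rcases p with _ | p
      · simp
      · apply mul_le_mul_of_nonneg_left _ (by positivity)
        have h3 := ih p (ℓ + 1) (by omega) (by omega)
        have h4 := hmono i (p + 1)
        have hmx := le_max_left (v i (p + 1) (ℓ + 1) - v i p (ℓ + 2)) 0
        have hmx0 := le_max_right (v i (p + 1) (ℓ + 1) - v i p (ℓ + 2)) 0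
        simp only [Nat.add_sub_cancel]
        rcases le_total 0 (v i (p + 1 + 1) ℓ - v i (p + 1) (ℓ + 1)) with h' | h'
        · rw [min_eq_right h', auxF_step]
          change _ ≤ v i (p + 1) (ℓ + 1) - v i p (ℓ + 2) at h3
          linarith
        · rw [min_eq_left h']
          linarith
    generalize min (v i (p + 1) ℓ - v i p (ℓ + 1)) 0
        + max (v i p (ℓ + 1) - v i (p - 1) (ℓ + 2)) 0 = Δ₁ at *
    generalize min (v i (p + 2) (ℓ - 1) - v i (p + 1) ℓ) 0
      + max (v i (p + 1) ℓ - v i p (ℓ + 1)) 0 = Δ₂ at *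
    generalize v (i + 1) (p + 1) ℓ - v (i + 1) p (ℓ + 1) = D at *
    generalize auxF C₁ C₂ μ₁ μ₂ h₀ h₁ h₂ i p = Fp at *
    generalize auxF C₁ C₂ μ₁ μ₂ h₀ h₁ h₂ (i + 1) p = Fm at *
    generalize (C₂ : ℝ) * μ₂ = b at *
    have hp : (0 : ℝ) ≤ p := by positivity
    generalize (p : ℝ) = q at *
    have hA : 0 < q * μ₁ + b := by positivity
    have k1 : μ₁ * ((q + 1) * μ₁ + b) * (q * Fm) ≤ μ₁ * ((q + 1) * μ₁ + b) * (q * Δ₁) :=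
      mul_le_mul_of_nonneg_left hΔ1 (by positivity)
    have k2 : b * (q * μ₁ + b) * Fp ≤ b * (q * μ₁ + b) * Δ₂ :=
      mul_le_mul_of_nonneg_left hΔ2 (by positivity)
    have kA : (q * μ₁ + b) * (b * Fp) = (q * μ₁ + b) * (b * Fm + h₀) := by rw [hF]
    have hP : 0 < (q * μ₁ + b) * ((q + 1) * μ₁ + b) := by positivity
    refine le_of_mul_le_mul_left ?_ hP
    linarith

theorem stmt15
    (C₁ C₂ : ℕ) (hC₂pos : 1 ≤ C₂) (hC : C₂ < C₁)
    (μ₁ μ₂ h₀ h₁ h₂ : ℝ)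
    (hμ₁ : 0 < μ₁) (hμ₂ : 0 < μ₂)
    (hh₀ : 0 < h₀) (hh₁ : 0 < h₁) (hh₂ : 0 < h₂)
    (v : ℕ → ℕ → ℕ → ℝ) (hv : IsValue C₁ C₂ μ₁ μ₂ h₀ h₁ h₂ v)
    (hcost : h₂ / μ₂ ≤ h₁ / μ₁) :
    ∀ i k ℓ : ℕ, k + ℓ = C₁ → 1 ≤ k → C₂ ≤ ℓ →
      ((h₂ ≤ h₀ → 0 ≤ Dv v i k ℓ →
        Dv v i k ℓ ≤
          ((i : ℝ) - (((k : ℝ) - 1) + ((min ℓ C₂ : ℕ) : ℝ) * (μ₂ / μ₁))) *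
              (-h₀ / ((C₂ : ℝ) * μ₂))
            + ((h₁ - h₂) / μ₁ - (C₁ : ℝ) * h₂ / ((C₂ : ℝ) * μ₂))) ∧
      (h₀ ≤ h₂ →
        ((i : ℝ) - (((k : ℝ) - 1) + ((min ℓ C₂ : ℕ) : ℝ) * (μ₂ / μ₁))) *
              (-h₀ / ((C₂ : ℝ) * μ₂))
            + ((h₁ - h₂) / μ₁ - (C₁ : ℝ) * h₂ / ((C₂ : ℝ) * μ₂)) ≤ Dv v i k ℓ) ∧
      (h₀ = h₂ → 0 ≤ Dv v i k ℓ →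
        Dv v i k ℓ =
          ((i : ℝ) - (((k : ℝ) - 1) + ((min ℓ C₂ : ℕ) : ℝ) * (μ₂ / μ₁))) *
              (-h₀ / ((C₂ : ℝ) * μ₂))
            + ((h₁ - h₂) / μ₁ - (C₁ : ℝ) * h₂ / ((C₂ : ℝ) * μ₂)))) := by

  intro i k ℓ h hk hl
  obtain ⟨p, rfl⟩ : ∃ p, k = p + 1 := ⟨k - 1, by omega⟩
  have hD : Dv v i (p + 1) ℓ = v i (p + 1) ℓ - v i p (ℓ + 1) := rfl
  have hF : ((i : ℝ) - ((((p + 1 : ℕ) : ℝ) - 1) + ((min ℓ C₂ : ℕ) : ℝ) * (μ₂ / μ₁))) *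
              (-h₀ / ((C₂ : ℝ) * μ₂))
            + ((h₁ - h₂) / μ₁ - (C₁ : ℝ) * h₂ / ((C₂ : ℝ) * μ₂)) =
      auxF C₁ C₂ μ₁ μ₂ h₀ h₁ h₂ i p := by
    rw [min_eq_right hl, auxF]; push_cast; ring
  rw [hF, hD]
  have hup := fun hle => aux_upper C₁ C₂ hC₂pos μ₁ μ₂ h₀ h₁ h₂ hμ₁ hμ₂ hh₀ v hv hle i p ℓ h hl
  have hlo := fun hle =>
    aux_lower C₁ C₂ hC₂pos hC μ₁ μ₂ h₀ h₁ h₂ hμ₁ hμ₂ hh₀ v hv hcost hle i p ℓ h hl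
  exact ⟨hup, hlo, fun he hpos => le_antisymm (hup he.ge hpos) (hlo he.le)⟩
end

section
/- Assume h₁/μ₁ > h₂/μ₂. Fix k with 1 ≤ k ≤ C₁ and ℓ = C₁ − k < C₂. If μ₁ > μ₂, then the set {i ∈ ℤ≥0 : D(i,k,ℓ) ≤ 0} is nonempty, and its least element i_D(k) satisfies ⌈R₁⌉ ≤ i_D(k) ≤ ⌈R₁⌉ + (C₁ − 1), where R₁ = −b/c (a positive real number, since b > 0 and c < 0 under these hypotheses). If instead μ₁ ≤ μ₂, then D(i,k,ℓ) > 0 for all i ≥ 0. -/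
/-- Difference identity for two consecutive states. -/
lemma aux_ident (k m m' μ₁ μ₂ a a' A A' c c' P Q R N : ℝ)
    (h1 : (k * μ₁ + m * μ₂) * A = c + k * μ₁ * (a - P) + m * μ₂ * (a - Q))
    (h2 : ((k-1) * μ₁ + m' * μ₂) * A' = c' + (k-1) * μ₁ * (a' - R) + m' * μ₂ * (a' - N))
    (h3 : a - a' = P - N) :
    (k * μ₁ + m * μ₂) * ((k-1) * μ₁ + m' * μ₂) * (A - A') =
      (((k-1) * μ₁ + m' * μ₂) * c - (k * μ₁ + m * μ₂) * c')
      + ((k-1) * μ₁ + m' * μ₂) * (m * μ₂) * (P - Q)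
      + (k * μ₁ + m * μ₂) * ((k-1) * μ₁) * (R - N) := by
  linear_combination ((k-1) * μ₁ + m' * μ₂) * h1 - (k * μ₁ + m * μ₂) * h2
    + (k * μ₁ + m * μ₂) * ((k-1) * μ₁ + m' * μ₂) * h3

/-- Common step for the upper bound. -/
lemma aux_upper_s17 (d d' s σ τ μ₁ y γ X P R : ℝ) (hμ : 0 < μ₁) (hγ : 0 < γ)
    (hd : 0 < d) (hd' : 0 < d') (hs : 0 ≤ s) (hτ : 0 ≤ τ) (hσ : 0 ≤ σ)
    (hdd : d' ≤ d) (hd1 : μ₁ ≤ d)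
    (hP : P ≤ max (y + γ * (d / μ₁ - 1)) 0)
    (hR : τ * R ≤ τ * max (y + γ * (d' / μ₁ - 1)) 0)
    (hsum : σ + d' * s + d * τ = d * d')
    (hlin : σ * (d / μ₁ - 1) + d * τ * ((d - d') / μ₁ - 1) = d' * s)
    (htr : d' * s * ((d - d') / μ₁) ≤ σ * (d' / μ₁))
    (hX : d * d' * X ≤ σ * (y - γ) + d' * s * P + d * (τ * R)) :
    X ≤ max (y - γ + γ * (d / μ₁ - 1)) 0 := by
  have hdd0 : 0 < d * d' := mul_pos hd hd'
  have hle : d' / μ₁ ≤ d / μ₁ := by gcongr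
  have hd1' : 1 ≤ d / μ₁ := by rwa [le_div_iff₀ hμ, one_mul]
  have e1 : (d - d') / μ₁ = d / μ₁ - d' / μ₁ := by ring
  rw [e1] at hlin htr
  have hX2 : d * d' * X ≤ σ * (y - γ) + d' * s * max (y + γ * (d / μ₁ - 1)) 0
      + d * (τ * max (y + γ * (d' / μ₁ - 1)) 0) := by
    have a1 := mul_le_mul_of_nonneg_left hP (mul_nonneg hd'.le hs)
    have a2 := mul_le_mul_of_nonneg_left hR hd.le
    linarith
  generalize d / μ₁ = e at *
  generalize d' / μ₁ = e' at *
  by_cases hU' : 0 ≤ y + γ * (e' - 1)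
  · have hU : 0 ≤ y + γ * (e - 1) := by nlinarith
    rw [max_eq_left hU, max_eq_left hU'] at hX2
    apply le_max_of_le_left
    refine le_of_mul_le_mul_left (hX2.trans (le_of_eq ?_)) hdd0
    linear_combination (y - γ + γ * (e - 1)) * hsum - γ * hlin
  · push Not at hU'
    apply le_max_of_le_right
    rw [max_eq_right hU'.le] at hX2
    have key : σ * (y - γ) + d' * s * max (y + γ * (e - 1)) 0 ≤ 0 := by
      rcases le_total 0 (y + γ * (e - 1)) with hU | hU
      · rw [max_eq_left hU]
        have b1 : y + γ * (e - 1) ≤ γ * (e - e') := by nlinarith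
        have b2 : y - γ ≤ - (γ * e') := by nlinarith
        have b3 := mul_le_mul_of_nonneg_left b1 (mul_nonneg hd'.le hs)
        have b4 := mul_le_mul_of_nonneg_left b2 hσ
        have b5 := mul_le_mul_of_nonneg_left htr hγ.le
        nlinarith
      · rw [max_eq_right hU]
        have : y - γ ≤ 0 := by nlinarith
        nlinarith
    by_contra hc
    push Not at hc
    have := mul_pos hdd0 hc
    linarith

lemma aux_max (x : ℝ) : x = max x 0 - max (-x) 0 := by
  rcases le_total 0 x with h | h
  · rw [max_eq_left h, max_eq_right (by linarith)]; ring
  · rw [max_eq_right h, max_eq_left (by linarith)]; ring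

lemma aux_min1 (a a' : ℝ) : min a a' = a - max (a - a') 0 := by
  rcases le_total a a' with h | h
  · rw [min_eq_left h, max_eq_right (by linarith)]; ring
  · rw [min_eq_right h, max_eq_left (by linarith)]; ring

lemma aux_min2 (a a1 : ℝ) : min a1 a = a - max (-(a1 - a)) 0 := by
  rcases le_total a1 a with h | h
  · rw [min_eq_left h, max_eq_left (by linarith)]; ring
  · rw [min_eq_right h, max_eq_right (by linarith)]; ring

lemma dRate_pos' (C₂ : ℕ) (hC₂ : 1 ≤ C₂) (μ₁ μ₂ : ℝ) (hμ₁ : 0 < μ₁) (hμ₂ : 0 < μ₂) (k l : ℕ)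
    (h : ¬ (k = 0 ∧ l = 0)) : 0 < dRate C₂ μ₁ μ₂ k l := by
  unfold dRate
  by_cases hk : k = 0
  · have : 0 < min l C₂ := by omega
    have : (0:ℝ) < ((min l C₂ : ℕ) : ℝ) := by exact_mod_cast this
    positivity
  · have : (0:ℝ) < (k:ℝ) := by exact_mod_cast Nat.pos_of_ne_zero hk
    positivity

/-- Value with empty queue. -/
noncomputable def gAux (C₂ : ℕ) (μ₂ h₂ : ℝ) : ℕ → ℝ
  | 0 => 0
  | l + 1 => gAux C₂ μ₂ h₂ l + ((l : ℝ) + 1) * h₂ / (((min (l+1) C₂ : ℕ) : ℝ) * μ₂)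

lemma v_zero (C₁ C₂ : ℕ) (hC₂ : 1 ≤ C₂) (μ₁ μ₂ h₀ h₁ h₂ : ℝ) (hμ₁ : 0 < μ₁) (hμ₂ : 0 < μ₂)
    (v : ℕ → ℕ → ℕ → ℝ) (hv : IsValue C₁ C₂ μ₁ μ₂ h₀ h₁ h₂ v) :
    ∀ n k l : ℕ, k + l = n → n ≤ C₁ → v 0 k l = k * (h₁ / μ₁) + gAux C₂ μ₂ h₂ l := by
  intro n
  induction n with
  | zero =>
    intro k l h _
    obtain ⟨rfl, rfl⟩ : k = 0 ∧ l = 0 := by omega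
    simp [gAux, hv.1]
  | succ n ih =>
    intro k l h hn
    have hd := dRate_pos' C₂ hC₂ μ₁ μ₂ hμ₁ hμ₂ k l (by omega)
    rw [hv.2.1 k l (by omega) (by omega)]
    have hk : (k:ℝ) * μ₁ * v 0 (k-1) l
        = k * μ₁ * (k * (h₁/μ₁) + gAux C₂ μ₂ h₂ l) - k * h₁ := by
      rcases k with _ | k
      · simp
      · rw [Nat.add_sub_cancel, ih k l (by omega) (by omega)]
        push_cast; field_simp; ring
    have hl : ((min l C₂ : ℕ):ℝ) * μ₂ * v 0 k (l-1)
        = (min l C₂ : ℕ) * μ₂ * (k * (h₁/μ₁) + gAux C₂ μ₂ h₂ l) - l * h₂ := by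
      rcases l with _ | l
      · simp
      · rw [Nat.add_sub_cancel, ih k l (by omega) (by omega)]
        have : 0 < min (l+1) C₂ := by omega
        have : (0:ℝ) < ((min (l+1) C₂ : ℕ) : ℝ) := by exact_mod_cast this
        rw [gAux]
        generalize ((min (l+1) C₂ : ℕ) : ℝ) = m at *
        push_cast; field_simp; ring
    have hdd : dRate C₂ μ₁ μ₂ k l = (k : ℝ) * μ₁ + ((min l C₂ : ℕ) : ℝ) * μ₂ := rfl
    rw [div_mul_eq_mul_div, div_mul_eq_mul_div, ← add_div, ← add_div, div_eq_iff hd.ne', hk, hl,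
      hdd]
    ring

/-- The recursion for the differences. -/
lemma D_rec (C₁ C₂ : ℕ) (hC₂ : 1 ≤ C₂) (hC : C₂ < C₁)
    (μ₁ μ₂ h₀ h₁ h₂ : ℝ) (hμ₁ : 0 < μ₁) (hμ₂ : 0 < μ₂)
    (v : ℕ → ℕ → ℕ → ℝ) (hv : IsValue C₁ C₂ μ₁ μ₂ h₀ h₁ h₂ v)
    (i k l : ℕ) (hkl : (k + 1) + l = C₁) :
    dRate C₂ μ₁ μ₂ (k+1) l * dRate C₂ μ₁ μ₂ k (l+1) * Dv v (i+1) (k+1) l =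
      (dRate C₂ μ₁ μ₂ k (l+1) * (((i:ℝ)+1) * h₀ + ((k:ℝ)+1) * h₁ + l * h₂)
        - dRate C₂ μ₁ μ₂ (k+1) l * (((i:ℝ)+1) * h₀ + (k:ℝ) * h₁ + ((l:ℝ)+1) * h₂))
      + dRate C₂ μ₁ μ₂ k (l+1) * (((min l C₂ : ℕ) : ℝ) * μ₂)
          * (max (Dv v i (k+1) l) 0 - max (-(Dv v i (k+2) (l-1))) 0)
      + dRate C₂ μ₁ μ₂ (k+1) l * ((k : ℝ) * μ₁)
          * (max (Dv v i k (l+1)) 0 - max (-(Dv v i (k+1) l)) 0) := by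
  have hd := dRate_pos' C₂ hC₂ μ₁ μ₂ hμ₁ hμ₂ (k+1) l (by omega)
  have hd' := dRate_pos' C₂ hC₂ μ₁ μ₂ hμ₁ hμ₂ k (l+1) (by omega)
  have E1 := hv.2.2 i (k+1) l hkl
  have E2 := hv.2.2 i k (l+1) (by omega)
  rw [div_mul_eq_mul_div, div_mul_eq_mul_div, ← add_div, ← add_div, eq_div_iff hd.ne'] at E1
  rw [div_mul_eq_mul_div, div_mul_eq_mul_div, ← add_div, ← add_div, eq_div_iff hd'.ne'] at E2
  rw [aux_min1, aux_min2] at E1 E2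
  have hD1 : ∀ j, Dv v j (k+1) l = v j (k+1) l - v j k (l+1) := fun j => rfl
  have hD2 : ((min l C₂ : ℕ) : ℝ) * μ₂ * max (-(Dv v i (k+2) (l-1))) 0
      = ((min l C₂ : ℕ) : ℝ) * μ₂ * max (-(v i (k+1+1) (l-1) - v i (k+1) l)) 0 := by
    rcases l with _ | l
    · simp
    · rfl
  have hD3 : Dv v i k (l+1) = v i k (l+1) - v i (k-1) (l+1+1) := rfl
  have e1 : dRate C₂ μ₁ μ₂ (k+1) l = ((k:ℝ)+1) * μ₁ + ((min l C₂ : ℕ) : ℝ) * μ₂ := by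
    simp [dRate]
  have e2 : dRate C₂ μ₁ μ₂ k (l+1) = (((k:ℝ)+1)-1) * μ₁ + ((min (l+1) C₂ : ℕ) : ℝ) * μ₂ := by
    simp [dRate]
  rw [e1] at E1 ⊢
  rw [e2] at E2 ⊢
  rw [hD3, hD1, hD1]
  have key := aux_ident ((k:ℝ)+1) ((min l C₂ : ℕ) : ℝ) ((min (l+1) C₂ : ℕ) : ℝ) μ₁ μ₂
    (v i (k+1) l) (v i k (l+1)) (v (i+1) (k+1) l) (v (i+1) k (l+1))
    (((i:ℝ)+1) * h₀ + ((k:ℝ)+1) * h₁ + l * h₂)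
    (((i:ℝ)+1) * h₀ + (k:ℝ) * h₁ + ((l:ℝ)+1) * h₂)
    (max (v i (k+1) l - v i k (l+1)) 0) (max (-(v i (k+1+1) (l-1) - v i (k+1) l)) 0)
    (max (v i k (l+1) - v i (k-1) (l+1+1)) 0) (max (-(v i (k+1) l - v i k (l+1))) 0)
    (by simp only [Nat.add_sub_cancel] at E1; push_cast at E1 ⊢; linear_combination E1)
    (by simp only [Nat.add_sub_cancel] at E2; push_cast at E2 ⊢; linear_combination E2)
    (aux_max _)
  linear_combination key + ((((k:ℝ)+1)-1) * μ₁ + ((min (l+1) C₂ : ℕ) : ℝ) * μ₂) * hD2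

lemma D_zero (C₁ C₂ : ℕ) (hC₂ : 1 ≤ C₂) (μ₁ μ₂ h₀ h₁ h₂ : ℝ) (hμ₁ : 0 < μ₁) (hμ₂ : 0 < μ₂)
    (v : ℕ → ℕ → ℕ → ℝ) (hv : IsValue C₁ C₂ μ₁ μ₂ h₀ h₁ h₂ v)
    (k l : ℕ) (hkl : (k + 1) + l = C₁) :
    Dv v 0 (k+1) l = h₁ / μ₁ - ((l : ℝ) + 1) * h₂ / (((min (l+1) C₂ : ℕ) : ℝ) * μ₂) := by
  unfold Dv
  rw [Nat.add_sub_cancel, v_zero C₁ C₂ hC₂ μ₁ μ₂ h₀ h₁ h₂ hμ₁ hμ₂ v hv _ (k+1) l rfl (by omega),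
    v_zero C₁ C₂ hC₂ μ₁ μ₂ h₀ h₁ h₂ hμ₁ hμ₂ v hv _ k (l+1) rfl (by omega), gAux]
  push_cast; ring

lemma D_lower (C₁ C₂ : ℕ) (hC₂ : 1 ≤ C₂) (hC : C₂ < C₁)
    (μ₁ μ₂ h₀ h₁ h₂ : ℝ) (hμ₁ : 0 < μ₁) (hμ₂ : 0 < μ₂) (hh₀ : 0 < h₀)
    (v : ℕ → ℕ → ℕ → ℝ) (hv : IsValue C₁ C₂ μ₁ μ₂ h₀ h₁ h₂ v)
    (hcost : h₂ / μ₂ < h₁ / μ₁) (i : ℕ) :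
    0 < C₁ * (μ₂ * h₁ - μ₁ * h₂) - (μ₁ - μ₂) * i * h₀ →
    ∀ k l : ℕ, (k+1) + l = C₁ → l < C₂ → 0 < Dv v i (k+1) l := by
  have hb : 0 < μ₂ * h₁ - μ₁ * h₂ := by
    rw [div_lt_div_iff₀ hμ₂ hμ₁] at hcost; linarith
  have hC1 : (0:ℝ) < C₁ := by exact_mod_cast (by omega : 0 < C₁)
  induction i with
  | zero =>
    intro _ k l hkl hl
    rw [D_zero C₁ C₂ hC₂ μ₁ μ₂ h₀ h₁ h₂ hμ₁ hμ₂ v hv k l hkl, min_eq_left (by omega)]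
    have : ((l:ℝ)+1) * h₂ / (((l+1:ℕ):ℝ) * μ₂) = h₂ / μ₂ := by
      push_cast; field_simp
    rw [this]; linarith
  | succ i ih =>
    intro hT k l hkl hl
    have hT' : 0 < C₁ * (μ₂ * h₁ - μ₁ * h₂) - (μ₁ - μ₂) * i * h₀ := by
      push_cast at hT
      rcases le_total μ₁ μ₂ with h | h
      · have : 0 ≤ (μ₂ - μ₁) * i * h₀ := by
          have : 0 ≤ μ₂ - μ₁ := by linarith
          positivity
        nlinarith [mul_pos hC1 hb]
      · have : 0 ≤ (μ₁ - μ₂) * h₀ := mul_nonneg (by linarith) hh₀.le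
        nlinarith
    have hpos := ih hT'
    have R := D_rec C₁ C₂ hC₂ hC μ₁ μ₂ h₀ h₁ h₂ hμ₁ hμ₂ v hv i k l hkl
    have hd := dRate_pos' C₂ hC₂ μ₁ μ₂ hμ₁ hμ₂ (k+1) l (by omega)
    have hd' := dRate_pos' C₂ hC₂ μ₁ μ₂ hμ₁ hμ₂ k (l+1) (by omega)
    have hz : max (-(Dv v i (k+1) l)) 0 = 0 := max_eq_right (by linarith [hpos k l hkl hl])
    have hq : ((min l C₂ : ℕ) : ℝ) * μ₂ * max (-(Dv v i (k+2) (l-1))) 0 = 0 := by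
      rcases l with _ | l
      · simp
      · rw [Nat.add_sub_cancel, max_eq_right, mul_zero]
        linarith [hpos (k+1) l (by omega) (by omega)]
    have hS : dRate C₂ μ₁ μ₂ k (l+1) * (((i:ℝ)+1) * h₀ + ((k:ℝ)+1) * h₁ + l * h₂)
        - dRate C₂ μ₁ μ₂ (k+1) l * (((i:ℝ)+1) * h₀ + (k:ℝ) * h₁ + ((l:ℝ)+1) * h₂)
        = C₁ * (μ₂ * h₁ - μ₁ * h₂) - (μ₁ - μ₂) * (i+1:ℕ) * h₀ := by
      unfold dRate
      rw [min_eq_left hl.le, min_eq_left (by omega : l+1 ≤ C₂), ← hkl]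
      push_cast; ring
    rw [hS, hz] at R
    have p1 : 0 ≤ dRate C₂ μ₁ μ₂ k (l+1) * (((min l C₂ : ℕ) : ℝ) * μ₂)
        * max (Dv v i (k+1) l) 0 := by positivity
    have p2 : 0 ≤ dRate C₂ μ₁ μ₂ (k+1) l * ((k : ℝ) * μ₁) * max (Dv v i k (l+1)) 0 := by
      positivity
    have : 0 < dRate C₂ μ₁ μ₂ (k+1) l * dRate C₂ μ₁ μ₂ k (l+1) * Dv v (i+1) (k+1) l := by
      rw [R]
      have : dRate C₂ μ₁ μ₂ k (l+1) * (((min l C₂ : ℕ) : ℝ) * μ₂)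
        * max (-(Dv v i (k+2) (l-1))) 0 = 0 := by rw [mul_assoc, hq, mul_zero]
      linarith
    exact (pos_iff_pos_of_mul_pos this).1 (mul_pos hd hd')

lemma D_upper (C₁ C₂ : ℕ) (hC₂ : 1 ≤ C₂) (hC : C₂ < C₁)
    (μ₁ μ₂ h₀ h₁ h₂ : ℝ) (hμ₁ : 0 < μ₁) (hμ₂ : 0 < μ₂)
    (hh₀ : 0 < h₀) (hh₁ : 0 < h₁) (hh₂ : 0 < h₂)
    (v : ℕ → ℕ → ℕ → ℝ) (hv : IsValue C₁ C₂ μ₁ μ₂ h₀ h₁ h₂ v) (hμ : μ₂ < μ₁)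
    (β γ : ℝ) (hβ : β = h₁ / μ₁ - h₂ / μ₂) (hγ : γ = h₀ / C₁ * (1 / μ₂ - 1 / μ₁)) (i : ℕ) :
    ∀ k l : ℕ, (k+1) + l = C₁ →
      Dv v i (k+1) l ≤ max (β - i * γ + γ * (dRate C₂ μ₁ μ₂ (k+1) l / μ₁ - 1)) 0 := by
  have hC1 : (0:ℝ) < C₁ := by exact_mod_cast (by omega : 0 < C₁)
  have hC2 : (0:ℝ) < C₂ := by exact_mod_cast (by omega : 0 < C₂)
  have hC12 : (C₂:ℝ) ≤ C₁ := by exact_mod_cast hC.le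
  have hγ0 : 0 < γ := by
    rw [hγ]
    have : 1 / μ₁ < 1 / μ₂ := one_div_lt_one_div_of_lt hμ₂ hμ
    exact mul_pos (by positivity) (by linarith)
  have hdge : ∀ k l : ℕ, μ₁ ≤ dRate C₂ μ₁ μ₂ (k+1) l := by
    intro k l
    unfold dRate
    push_cast
    have : 0 ≤ (k:ℝ) * μ₁ := by positivity
    have : 0 ≤ (min (l:ℝ) C₂) * μ₂ := by positivity
    linarith
  induction i with
  | zero =>
    intro k l hkl
    apply le_max_of_le_left
    rw [D_zero C₁ C₂ hC₂ μ₁ μ₂ h₀ h₁ h₂ hμ₁ hμ₂ v hv k l hkl]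
    have h1 : 1 ≤ dRate C₂ μ₁ μ₂ (k+1) l / μ₁ := by
      rw [le_div_iff₀ hμ₁, one_mul]; exact hdge k l
    have h2 : h₂ / μ₂ ≤ ((l : ℝ) + 1) * h₂ / (((min (l+1) C₂ : ℕ) : ℝ) * μ₂) := by
      have a : 0 < min (l+1) C₂ := by omega
      have a : (0:ℝ) < ((min (l+1) C₂ : ℕ) : ℝ) := by exact_mod_cast a
      have b : ((min (l+1) C₂ : ℕ) : ℝ) ≤ (l:ℝ) + 1 := by
        exact_mod_cast min_le_left (l+1) C₂
      rw [div_le_div_iff₀ hμ₂ (by positivity)]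
      have := mul_le_mul_of_nonneg_right b (mul_pos hh₂ hμ₂).le
      linarith
    have h3 : 0 ≤ γ * (dRate C₂ μ₁ μ₂ (k+1) l / μ₁ - 1) := mul_nonneg hγ0.le (by linarith)
    rw [hβ, Nat.cast_zero]; linarith
  | succ i ih =>
    intro k l hkl
    have R := D_rec C₁ C₂ hC₂ hC μ₁ μ₂ h₀ h₁ h₂ hμ₁ hμ₂ v hv i k l hkl
    have hd := dRate_pos' C₂ hC₂ μ₁ μ₂ hμ₁ hμ₂ (k+1) l (by omega)
    have hd' := dRate_pos' C₂ hC₂ μ₁ μ₂ hμ₁ hμ₂ k (l+1) (by omega)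
    have hP := ih k l hkl
    have hP' : max (Dv v i (k+1) l) 0
        ≤ max (β - i * γ + γ * (dRate C₂ μ₁ μ₂ (k+1) l / μ₁ - 1)) 0 :=
      max_le hP (le_max_right _ _)
    have hR : (k:ℝ) * μ₁ * max (Dv v i k (l+1)) 0
        ≤ (k:ℝ) * μ₁ * max (β - i * γ + γ * (dRate C₂ μ₁ μ₂ k (l+1) / μ₁ - 1)) 0 := by
      rcases k with _ | k
      · simp
      · exact mul_le_mul_of_nonneg_left
          (max_le (ih k (l+1) (by omega)) (le_max_right _ _)) (by positivity)
    have n1 : 0 ≤ dRate C₂ μ₁ μ₂ k (l+1) * (((min l C₂ : ℕ) : ℝ) * μ₂)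
        * max (-(Dv v i (k+2) (l-1))) 0 := by positivity
    have n2 : 0 ≤ dRate C₂ μ₁ μ₂ (k+1) l * ((k : ℝ) * μ₁) * max (-(Dv v i (k+1) l)) 0 := by
      positivity
    have hcast : β - ((i+1:ℕ):ℝ) * γ = β - i * γ - γ := by push_cast; ring
    rw [hcast]
    have hs : 0 ≤ ((min l C₂ : ℕ) : ℝ) * μ₂ := by positivity
    have hk0 : 0 ≤ (k:ℝ) * μ₁ := by positivity
    have hkl' : (C₁:ℝ) = (k:ℝ) + 1 + l := by rw [← hkl]; push_cast; ring
    have hl0 : (0:ℝ) ≤ l := by positivity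
    have hk0' : (0:ℝ) ≤ k := by positivity
    by_cases hl : l < C₂
    · have e1 : dRate C₂ μ₁ μ₂ (k+1) l = ((k:ℝ)+1) * μ₁ + l * μ₂ := by
        unfold dRate; rw [min_eq_left hl.le]; push_cast; ring
      have e2 : dRate C₂ μ₁ μ₂ k (l+1) = (k:ℝ) * μ₁ + (l+1) * μ₂ := by
        unfold dRate; rw [min_eq_left (by omega : l+1 ≤ C₂)]; push_cast; ring
      have e3 : ((min l C₂ : ℕ) : ℝ) = l := by rw [min_eq_left hl.le]
      refine aux_upper_s17 _ (dRate C₂ μ₁ μ₂ k (l+1)) (((min l C₂ : ℕ) : ℝ) * μ₂)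
        (C₁ * μ₁ * μ₂) ((k:ℝ) * μ₁) μ₁ _ γ _ _ _ hμ₁ hγ0 hd hd' hs hk0 (by positivity)
        ?_ (hdge k l) hP' hR ?_ ?_ ?_ ?_
      · rw [e1, e2]; linarith
      · rw [e1, e2, e3, hkl']; ring
      · rw [e1, e2, e3, hkl']; field_simp; ring
      · rw [e1, e2, e3]
        have : ((k:ℝ) * μ₁ + (l+1) * μ₂) * (l * μ₂) * ((((k:ℝ)+1) * μ₁ + l * μ₂ - ((k:ℝ) * μ₁ + (l+1) * μ₂)) / μ₁)
          = ((k:ℝ) * μ₁ + (l+1) * μ₂) * μ₂ * (l * ((μ₁ - μ₂) / μ₁)) := by ring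
        rw [this]
        have : (C₁:ℝ) * μ₁ * μ₂ * (((k:ℝ) * μ₁ + (l+1) * μ₂) / μ₁)
          = ((k:ℝ) * μ₁ + (l+1) * μ₂) * μ₂ * C₁ := by field_simp
        rw [this]
        apply mul_le_mul_of_nonneg_left _ (by positivity)
        have : (μ₁ - μ₂) / μ₁ ≤ 1 := by rw [div_le_one hμ₁]; linarith
        nlinarith
      · have hS : dRate C₂ μ₁ μ₂ k (l+1) * (((i:ℝ)+1) * h₀ + ((k:ℝ)+1) * h₁ + l * h₂)
          - dRate C₂ μ₁ μ₂ (k+1) l * (((i:ℝ)+1) * h₀ + (k:ℝ) * h₁ + ((l:ℝ)+1) * h₂)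
          = C₁ * μ₁ * μ₂ * (β - i * γ - γ) := by
          have : C₁ * μ₁ * μ₂ * (β - i * γ - γ)
            = C₁ * (μ₂ * h₁ - μ₁ * h₂) - (μ₁ - μ₂) * (i+1) * h₀ := by
            rw [hβ, hγ]; field_simp; ring
          rw [this, e1, e2, hkl']; ring
        rw [hS] at R
        rw [R]; linarith
    · push Not at hl
      have e1 : dRate C₂ μ₁ μ₂ (k+1) l = ((k:ℝ)+1) * μ₁ + C₂ * μ₂ := by
        unfold dRate; rw [min_eq_right hl]; push_cast; ring
      have e2 : dRate C₂ μ₁ μ₂ k (l+1) = (k:ℝ) * μ₁ + C₂ * μ₂ := by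
        unfold dRate; rw [min_eq_right (by omega : C₂ ≤ l+1)]
      have e3 : ((min l C₂ : ℕ) : ℝ) = C₂ := by rw [min_eq_right hl]
      refine aux_upper_s17 _ (dRate C₂ μ₁ μ₂ k (l+1)) (((min l C₂ : ℕ) : ℝ) * μ₂)
        (C₂ * μ₁ * μ₂) ((k:ℝ) * μ₁) μ₁ _ γ _ _ _ hμ₁ hγ0 hd hd' hs hk0 (by positivity)
        ?_ (hdge k l) hP' hR ?_ ?_ ?_ ?_
      · rw [e1, e2]; linarith
      · rw [e1, e2, e3]; ring
      · rw [e1, e2, e3]; field_simp; ring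
      · rw [e1, e2, e3]; apply le_of_eq; field_simp; ring
      · have hS : dRate C₂ μ₁ μ₂ k (l+1) * (((i:ℝ)+1) * h₀ + ((k:ℝ)+1) * h₁ + l * h₂)
          - dRate C₂ μ₁ μ₂ (k+1) l * (((i:ℝ)+1) * h₀ + (k:ℝ) * h₁ + ((l:ℝ)+1) * h₂)
          ≤ C₂ * μ₁ * μ₂ * (β - i * γ - γ) := by
          have a1 : C₂ * μ₁ * μ₂ * (β - i * γ - γ)
            = C₂ * (μ₂ * h₁ - μ₁ * h₂) - (C₂ / C₁) * ((μ₁ - μ₂) * ((i+1) * h₀)) := by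
            rw [hβ, hγ]; field_simp; ring
          have a2 : dRate C₂ μ₁ μ₂ k (l+1) * (((i:ℝ)+1) * h₀ + ((k:ℝ)+1) * h₁ + l * h₂)
            - dRate C₂ μ₁ μ₂ (k+1) l * (((i:ℝ)+1) * h₀ + (k:ℝ) * h₁ + ((l:ℝ)+1) * h₂)
            = C₂ * μ₂ * h₁ - (C₂ * μ₂ + C₁ * μ₁) * h₂ - μ₁ * ((i+1) * h₀) := by
            rw [e1, e2, hkl']; ring
          rw [a1, a2]
          have a3 : (C₂:ℝ) / C₁ ≤ 1 := by rw [div_le_one hC1]; exact hC12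
          have a4 : 0 ≤ ((i:ℝ)+1) * h₀ := by positivity
          have a5 : (C₂ / C₁ : ℝ) * ((μ₁ - μ₂) * ((i+1) * h₀)) ≤ 1 * ((μ₁ - μ₂) * ((i+1) * h₀)) :=
            mul_le_mul_of_nonneg_right a3 (mul_nonneg (by linarith) a4)
          have a6 : 0 ≤ μ₂ * (((i:ℝ)+1) * h₀) := by positivity
          have a7 : 0 ≤ (C₂:ℝ) * μ₂ * h₂ := by positivity
          have a8 : 0 ≤ ((C₁:ℝ) - C₂) * (μ₁ * h₂) := mul_nonneg (by linarith) (by positivity)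
          linarith
        rw [R]; linarith

theorem stmt17
    (C₁ C₂ : ℕ) (hC₂pos : 1 ≤ C₂) (hC : C₂ < C₁)
    (μ₁ μ₂ h₀ h₁ h₂ : ℝ)
    (hμ₁ : 0 < μ₁) (hμ₂ : 0 < μ₂)
    (hh₀ : 0 < h₀) (hh₁ : 0 < h₁) (hh₂ : 0 < h₂)
    (v : ℕ → ℕ → ℕ → ℝ) (hv : IsValue C₁ C₂ μ₁ μ₂ h₀ h₁ h₂ v)
    (hcost : h₂ / μ₂ < h₁ / μ₁)
    (k : ℕ) (hk1 : 1 ≤ k) (hkC : k ≤ C₁) (hℓ : C₁ - k < C₂) :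
    (μ₂ < μ₁ →
      {i : ℕ | Dv v i k (C₁ - k) ≤ 0}.Nonempty ∧
      ⌈-(h₁ / μ₁ - h₂ / μ₂) / (h₀ / (C₁ : ℝ) * (1 / μ₁ - 1 / μ₂))⌉ ≤
        ((sInf {i : ℕ | Dv v i k (C₁ - k) ≤ 0} : ℕ) : ℤ) ∧
      ((sInf {i : ℕ | Dv v i k (C₁ - k) ≤ 0} : ℕ) : ℤ) ≤
        ⌈-(h₁ / μ₁ - h₂ / μ₂) / (h₀ / (C₁ : ℝ) * (1 / μ₁ - 1 / μ₂))⌉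
          + ((C₁ - 1 : ℕ) : ℤ)) ∧
    (μ₁ ≤ μ₂ → ∀ i : ℕ, 0 < Dv v i k (C₁ - k)) := by
  obtain ⟨k, rfl⟩ : ∃ n, k = n + 1 := ⟨k - 1, by omega⟩
  generalize hl : C₁ - (k+1) = l at *
  have hkl : (k+1) + l = C₁ := by omega
  have hC1 : (0:ℝ) < C₁ := by exact_mod_cast (by omega : 0 < C₁)
  have hb : 0 < μ₂ * h₁ - μ₁ * h₂ := by
    have := hcost
    rw [div_lt_div_iff₀ hμ₂ hμ₁] at this; linarith
  have low := D_lower C₁ C₂ hC₂pos hC μ₁ μ₂ h₀ h₁ h₂ hμ₁ hμ₂ hh₀ v hv hcost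
  constructor
  · intro hμ
    obtain ⟨β, hβ⟩ : ∃ β, β = h₁ / μ₁ - h₂ / μ₂ := ⟨_, rfl⟩
    obtain ⟨γ, hγ⟩ : ∃ γ, γ = h₀ / C₁ * (1 / μ₂ - 1 / μ₁) := ⟨_, rfl⟩
    have up := D_upper C₁ C₂ hC₂pos hC μ₁ μ₂ h₀ h₁ h₂ hμ₁ hμ₂ hh₀ hh₁ hh₂ v hv hμ β γ hβ hγ
    have hγ0 : 0 < γ := by
      rw [hγ]
      have : 1 / μ₁ < 1 / μ₂ := one_div_lt_one_div_of_lt hμ₂ hμ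
      exact mul_pos (by positivity) (by linarith)
    have hβ0 : 0 < β := by rw [hβ]; linarith
    have hR : -(h₁ / μ₁ - h₂ / μ₂) / (h₀ / (C₁ : ℝ) * (1 / μ₁ - 1 / μ₂)) = β / γ := by
      have : h₀ / (C₁ : ℝ) * (1 / μ₁ - 1 / μ₂) = -γ := by rw [hγ]; ring
      rw [this, ← hβ, neg_div_neg_eq]
    rw [hR]
    have hRpos : 0 < β / γ := div_pos hβ0 hγ0
    have hcpos : 0 < ⌈β / γ⌉ := Int.ceil_pos.2 hRpos
    have hmem : (⌈β / γ⌉.toNat + (C₁ - 1)) ∈ {i : ℕ | Dv v i (k+1) l ≤ 0} := by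
      have h := up (⌈β / γ⌉.toNat + (C₁ - 1)) k l hkl
      rw [Set.mem_ofPred_eq]
      refine h.trans (max_le ?_ le_rfl)
      have hc : ((⌈β / γ⌉.toNat : ℕ) : ℝ) = (⌈β / γ⌉ : ℝ) := by
        exact_mod_cast congrArg (Int.cast : ℤ → ℝ) (Int.toNat_of_nonneg hcpos.le)
      have hge : β ≤ (⌈β / γ⌉ : ℝ) * γ := by
        rw [← div_le_iff₀ hγ0]; exact Int.le_ceil _
      have hd : dRate C₂ μ₁ μ₂ (k+1) l / μ₁ ≤ C₁ := by
        rw [div_le_iff₀ hμ₁]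
        unfold dRate
        rw [min_eq_left hℓ.le, ← hkl]
        push_cast
        have : (l:ℝ) * μ₂ ≤ l * μ₁ := by gcongr
        linarith
      have hd2 := mul_le_mul_of_nonneg_left hd hγ0.le
      rw [Nat.cast_add, hc, Nat.cast_sub (by omega : 1 ≤ C₁)]
      push_cast
      nlinarith
    refine ⟨⟨_, hmem⟩, ?_, ?_⟩
    · have hm := Nat.sInf_mem (⟨_, hmem⟩ : {i : ℕ | Dv v i (k+1) l ≤ 0}.Nonempty)
      generalize sInf {i : ℕ | Dv v i (k+1) l ≤ 0} = n at *
      rw [Set.mem_ofPred_eq] at hm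
      rw [Int.ceil_le]
      by_contra hc
      push Not at hc
      have hc2 : (n:ℝ) < β / γ := by exact_mod_cast hc
      rw [lt_div_iff₀ hγ0] at hc2
      have e : C₁ * (μ₂ * h₁ - μ₁ * h₂) - (μ₁ - μ₂) * n * h₀ = C₁ * μ₁ * μ₂ * (β - n * γ) := by
        rw [hβ, hγ]; field_simp
      have : 0 < C₁ * (μ₂ * h₁ - μ₁ * h₂) - (μ₁ - μ₂) * n * h₀ := by
        rw [e]; exact mul_pos (by positivity) (by linarith)
      linarith [low n this k l hkl hℓ]
    · have h := Nat.sInf_le hmem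
      have h' : ((sInf {i : ℕ | Dv v i (k+1) l ≤ 0} : ℕ) : ℤ)
          ≤ ((⌈β / γ⌉.toNat + (C₁ - 1) : ℕ) : ℤ) := by exact_mod_cast h
      rw [Nat.cast_add, Int.toNat_of_nonneg hcpos.le] at h'
      exact h'
  · intro hμ i
    refine low i ?_ k l hkl hℓ
    have : 0 ≤ (μ₂ - μ₁) * i * h₀ := by
      have : 0 ≤ μ₂ - μ₁ := by linarith
      positivity
    have := mul_pos hC1 hb
    linarith
end

section
/- Assume h₁/μ₁ > h₂/μ₂. Fix k with 1 ≤ k ≤ C₁ and ℓ = C₁ − k ≥ C₂, and suppose h₁/μ₁ > ((ℓ+1)/C₂)·(h₂/μ₂). Then the set {i ∈ ℤ≥0 : D(i,k,ℓ) ≤ 0} is nonempty and its least element i_D(k) satisfies i_D(k) ≥ 1. Let i_H(k) = max(⌈R₂(k)⌉, 0), where R₂(k) = (C₂·m·(h₁ − h₂) − C₁·h₂)/h₀ + (k − 1 + C₂·m) and m = μ₂/μ₁. Then: if h₀ ≥ h₂, i_H(k) ≥ i_D(k); if h₀ ≤ h₂, i_H(k) ≤ i_D(k); consequently, if h₀ =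 h₂ then i_H(k) = i_D(k). -/
/-- Number of busy class-two servers when `k` slots are of class one. -/
noncomputable def eRate (C₁ C₂ k : ℕ) : ℝ := ((min (C₁ - k) C₂ : ℕ) : ℝ)

/-- Increment of the class-two clearing cost. -/
noncomputable def sStep (C₂ : ℕ) (μ₂ h₂ : ℝ) (ℓ : ℕ) : ℝ :=
  ((ℓ : ℝ) * h₂) / (((min ℓ C₂ : ℕ) : ℝ) * μ₂)

/-- The value function restricted to full states, in terms of `(i,k)` only. -/
structure Core (C₁ C₂ : ℕ) (μ₁ μ₂ h₀ h₁ h₂ : ℝ) (V : ℕ → ℕ → ℝ) : Prop where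
  base : ∀ k, k < C₁ → V 0 (k + 1) - V 0 k = h₁ / μ₁ - sStep C₂ μ₂ h₂ (C₁ - k)
  step : ∀ i k, k ≤ C₁ → ((k : ℝ) * μ₁ + eRate C₁ C₂ k * μ₂) * V (i + 1) k =
    ((i : ℝ) + 1) * h₀ + (k : ℝ) * h₁ + ((C₁ : ℝ) - k) * h₂
      + (k : ℝ) * μ₁ * min (V i k) (V i (k - 1))
      + eRate C₁ C₂ k * μ₂ * min (V i (k + 1)) (V i k)

theorem sStep_mul (C₂ : ℕ) (hC₂ : 1 ≤ C₂) (μ₂ h₂ : ℝ) (hμ₂ : 0 < μ₂) (ℓ : ℕ) :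
    (((min ℓ C₂ : ℕ) : ℝ) * μ₂) * sStep C₂ μ₂ h₂ ℓ = (ℓ : ℝ) * h₂ := by
  unfold sStep
  rcases Nat.eq_zero_or_pos ℓ with h | h
  · subst h; simp
  · have : (0 : ℝ) < ((min ℓ C₂ : ℕ) : ℝ) := by
      exact_mod_cast (lt_min h (by omega))
    field_simp

theorem sStep_ge (C₂ : ℕ) (hC₂ : 1 ≤ C₂) (μ₂ h₂ : ℝ) (hμ₂ : 0 < μ₂) (hh₂ : 0 < h₂) (ℓ : ℕ)
    (hl : 1 ≤ ℓ) : h₂ / μ₂ ≤ sStep C₂ μ₂ h₂ ℓ := by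
  unfold sStep
  have h1 : (0 : ℝ) < ((min ℓ C₂ : ℕ) : ℝ) := by
    exact_mod_cast (lt_min hl (by omega))
  have h2 : ((min ℓ C₂ : ℕ) : ℝ) ≤ ℓ := by exact_mod_cast min_le_left _ _
  rw [div_le_div_iff₀ hμ₂ (by positivity)]
  nlinarith [mul_pos hμ₂ hh₂]

theorem sStep_hi (C₂ : ℕ) (μ₂ h₂ : ℝ) (ℓ : ℕ) (hl : C₂ ≤ ℓ) :
    sStep C₂ μ₂ h₂ ℓ = (ℓ : ℝ) * h₂ / ((C₂ : ℝ) * μ₂) := by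
  unfold sStep
  rw [min_eq_right hl]

theorem sStep_lo (C₂ : ℕ) (μ₂ h₂ : ℝ) (ℓ : ℕ) (h1 : 1 ≤ ℓ) (hl : ℓ ≤ C₂) :
    sStep C₂ μ₂ h₂ ℓ = h₂ / μ₂ := by
  unfold sStep
  rw [min_eq_left hl]
  have : (0 : ℝ) < (ℓ : ℝ) := by exact_mod_cast h1
  rw [mul_div_mul_left _ _ this.ne']

theorem dpos (C₁ C₂ : ℕ) (hC₂ : 1 ≤ C₂) (hC : C₂ < C₁) (μ₁ μ₂ : ℝ) (hμ₁ : 0 < μ₁) (hμ₂ : 0 < μ₂)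
    (k : ℕ) : 0 < (k : ℝ) * μ₁ + eRate C₁ C₂ k * μ₂ := by
  unfold eRate
  rcases Nat.eq_zero_or_pos k with h | h
  · subst h
    have : (0 : ℝ) < ((min (C₁ - 0) C₂ : ℕ) : ℝ) := by
      exact_mod_cast (lt_min (by omega) (by omega))
    have := mul_pos this hμ₂
    simpa using this
  · have : (0 : ℝ) < (k : ℝ) := by exact_mod_cast h
    positivity

/-- The clearing value at `i = 0` separates. -/
theorem value_zero (C₁ C₂ : ℕ) (hC₂ : 1 ≤ C₂) (μ₁ μ₂ h₀ h₁ h₂ : ℝ)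
    (hμ₁ : 0 < μ₁) (hμ₂ : 0 < μ₂) (v : ℕ → ℕ → ℕ → ℝ)
    (hv : IsValue C₁ C₂ μ₁ μ₂ h₀ h₁ h₂ v) :
    ∀ n k ℓ : ℕ, k + ℓ = n → n ≤ C₁ →
      v 0 k ℓ = (k : ℝ) * (h₁ / μ₁) + ∑ j ∈ Finset.range ℓ, sStep C₂ μ₂ h₂ (j + 1) := by
  obtain ⟨h00, h0, -⟩ := hv
  intro n
  induction n with
  | zero =>
    intro k ℓ hkl _
    obtain ⟨rfl, rfl⟩ : k = 0 ∧ ℓ = 0 := by omega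
    simp [h00]
  | succ n ih =>
    intro k ℓ hkl hn
    have hrec := h0 k ℓ (by omega) (by omega)
    have hm := sStep_mul C₂ hC₂ μ₂ h₂ hμ₂ ℓ
    have hd : 0 < dRate C₂ μ₁ μ₂ k ℓ := by
      unfold dRate
      rcases Nat.eq_zero_or_pos k with h | h
      · have : (0 : ℝ) < ((min ℓ C₂ : ℕ) : ℝ) := by
          exact_mod_cast (lt_min (by omega) (by omega))
        positivity
      · have : (0 : ℝ) < (k : ℝ) := by exact_mod_cast h
        positivity
    have e1 : (k : ℝ) * μ₁ * v 0 (k - 1) ℓ = (k : ℝ) * μ₁ *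
        (((k : ℝ) - 1) * (h₁ / μ₁) + ∑ j ∈ Finset.range ℓ, sStep C₂ μ₂ h₂ (j + 1)) := by
      rcases k with _ | k
      · simp
      · rw [Nat.add_sub_cancel, ih k ℓ (by omega) (by omega)]
        push_cast; ring
    have e2 : ((min ℓ C₂ : ℕ) : ℝ) * μ₂ * v 0 k (ℓ - 1) = ((min ℓ C₂ : ℕ) : ℝ) * μ₂ *
        ((k : ℝ) * (h₁ / μ₁) + ∑ j ∈ Finset.range ℓ, sStep C₂ μ₂ h₂ (j + 1)
          - sStep C₂ μ₂ h₂ ℓ) := by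
      rcases ℓ with _ | ℓ
      · simp
      · rw [Nat.add_sub_cancel, ih k ℓ (by omega) (by omega), Finset.sum_range_succ]
        ring
    have e3 : (k : ℝ) * μ₁ * (h₁ / μ₁) = k * h₁ := by field_simp
    have hrec' : dRate C₂ μ₁ μ₂ k ℓ * v 0 k ℓ = ((k : ℝ) * h₁ + (ℓ : ℝ) * h₂)
      + ((k : ℝ) * μ₁) * v 0 (k - 1) ℓ
      + (((min ℓ C₂ : ℕ) : ℝ) * μ₂) * v 0 k (ℓ - 1) := by
      rw [hrec]; field_simp
    rw [e1, e2] at hrec'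
    apply mul_left_cancel₀ hd.ne'
    rw [hrec']
    unfold dRate
    linear_combination -hm - e3

theorem core_of_value (C₁ C₂ : ℕ) (hC₂ : 1 ≤ C₂) (hC : C₂ < C₁) (μ₁ μ₂ h₀ h₁ h₂ : ℝ)
    (hμ₁ : 0 < μ₁) (hμ₂ : 0 < μ₂) (v : ℕ → ℕ → ℕ → ℝ)
    (hv : IsValue C₁ C₂ μ₁ μ₂ h₀ h₁ h₂ v) :
    Core C₁ C₂ μ₁ μ₂ h₀ h₁ h₂ (fun i k => v i k (C₁ - k)) := by
  have hz := value_zero C₁ C₂ hC₂ μ₁ μ₂ h₀ h₁ h₂ hμ₁ hμ₂ v hv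
  obtain ⟨-, -, h1⟩ := hv
  constructor
  · intro k hk
    obtain ⟨ℓ, rfl⟩ : ∃ ℓ, C₁ = k + ℓ + 1 := ⟨C₁ - k - 1, by omega⟩
    have a1 : k + ℓ + 1 - (k + 1) = ℓ := by omega
    have a2 : k + ℓ + 1 - k = ℓ + 1 := by omega
    rw [a1, a2, hz _ (k + 1) ℓ rfl (by omega), hz _ k (ℓ + 1) rfl (by omega),
      Finset.sum_range_succ]
    push_cast; ring
  · intro i k hk
    have hd := dpos C₁ C₂ hC₂ hC μ₁ μ₂ hμ₁ hμ₂ k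
    have hr := h1 i k (C₁ - k) (by omega)
    have a1 : C₁ - k - 1 = C₁ - (k + 1) := by omega
    have a2 : ((C₁ - k : ℕ) : ℝ) = (C₁ : ℝ) - k := by
      rw [Nat.cast_sub hk]
    have e1 : (k : ℝ) * μ₁ * min (v i k (C₁ - k)) (v i (k - 1) (C₁ - k + 1)) =
        (k : ℝ) * μ₁ * min (v i k (C₁ - k)) (v i (k - 1) (C₁ - (k - 1))) := by
      rcases k with _ | k
      · simp
      · have : C₁ - (k + 1) + 1 = C₁ - (k + 1 - 1) := by omega
        rw [this]
    rw [← e1, ← a1, ← a2]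
    have hdd : (k : ℝ) * μ₁ + eRate C₁ C₂ k * μ₂ = dRate C₂ μ₁ μ₂ k (C₁ - k) := rfl
    rw [hdd] at hd ⊢
    rw [hr]
    unfold eRate
    field_simp

theorem min_sub_ge (a b c d t : ℝ) (h1 : t ≤ a - c) (h2 : t ≤ b - d) :
    t ≤ min a b - min c d := by
  rcases min_cases a b with h | h <;> rcases min_cases c d with h' | h' <;> linarith

theorem min_sub_le (a b c d t : ℝ) (h1 : a - c ≤ t) (h2 : b - d ≤ t) :
    min a b - min c d ≤ t := by
  rcases min_cases a b with h | h <;> rcases min_cases c d with h' | h' <;> linarith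

theorem eRate_hi (C₁ C₂ k : ℕ) (h : k + C₂ ≤ C₁) : eRate C₁ C₂ k = C₂ := by
  unfold eRate
  rw [min_eq_right (by omega)]

theorem eRate_lo (C₁ C₂ k : ℕ) (h : C₁ ≤ k + C₂) (hk : k ≤ C₁) :
    eRate C₁ C₂ k = (C₁ : ℝ) - k := by
  unfold eRate
  rw [min_eq_left (by omega), Nat.cast_sub hk]

theorem eRate_nonneg (C₁ C₂ k : ℕ) : 0 ≤ eRate C₁ C₂ k := by
  unfold eRate; positivity

theorem eRate_top (C₁ C₂ : ℕ) : eRate C₁ C₂ C₁ = 0 := by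
  unfold eRate; simp

/-- First increment in `i`. -/
theorem delta_base (C₁ C₂ : ℕ) (hC₂ : 1 ≤ C₂) (μ₁ μ₂ h₀ h₁ h₂ : ℝ)
    (hμ₁ : 0 < μ₁) (hμ₂ : 0 < μ₂) (V : ℕ → ℕ → ℝ)
    (hV : Core C₁ C₂ μ₁ μ₂ h₀ h₁ h₂ V) (k : ℕ) (hk : k ≤ C₁) :
    ((k : ℝ) * μ₁ + eRate C₁ C₂ k * μ₂) * (V 1 k - V 0 k) =
      h₀ + (k : ℝ) * μ₁ * min (h₁ / μ₁) (sStep C₂ μ₂ h₂ (C₁ - (k - 1)))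
        + eRate C₁ C₂ k * μ₂ * min (h₁ / μ₁) (sStep C₂ μ₂ h₂ (C₁ - k)) := by
  have hs := hV.step 0 k hk
  have e0 : (k : ℝ) * μ₁ * (h₁ / μ₁) = k * h₁ := by field_simp
  have e3 := sStep_mul C₂ hC₂ μ₂ h₂ hμ₂ (C₁ - k)
  rw [Nat.cast_sub hk] at e3
  change eRate C₁ C₂ k * μ₂ * _ = _ at e3
  have e1 : (k : ℝ) * μ₁ * min (V 0 k) (V 0 (k - 1)) = (k : ℝ) * μ₁ *
      (V 0 k - h₁ / μ₁ + min (h₁ / μ₁) (sStep C₂ μ₂ h₂ (C₁ - (k - 1)))) := by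
    rcases k with _ | k
    · simp
    · have := hV.base k (by omega)
      simp only [Nat.add_sub_cancel]
      congr 1
      rw [← min_add_add_left]
      congr 1 <;> linarith
  have e2 : eRate C₁ C₂ k * μ₂ * min (V 0 (k + 1)) (V 0 k) = eRate C₁ C₂ k * μ₂ *
      (V 0 k - sStep C₂ μ₂ h₂ (C₁ - k) + min (h₁ / μ₁) (sStep C₂ μ₂ h₂ (C₁ - k))) := by
    rcases Nat.lt_or_ge k C₁ with h | h
    · have := hV.base k h
      congr 1
      rw [← min_add_add_left]
      congr 1 <;> linarith
    · obtain rfl : k = C₁ := by omega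
      rw [eRate_top]; simp
  rw [e1, e2] at hs
  norm_num at hs
  linear_combination hs - e0 - e3

/-- General increment in `i`. -/
theorem delta_step (C₁ C₂ : ℕ) (μ₁ μ₂ h₀ h₁ h₂ : ℝ) (V : ℕ → ℕ → ℝ)
    (hV : Core C₁ C₂ μ₁ μ₂ h₀ h₁ h₂ V) (i k : ℕ) (hk : k ≤ C₁) :
    ((k : ℝ) * μ₁ + eRate C₁ C₂ k * μ₂) * (V (i + 2) k - V (i + 1) k) =
      h₀ + (k : ℝ) * μ₁ * (min (V (i + 1) k) (V (i + 1) (k - 1)) - min (V i k) (V i (k - 1)))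
        + eRate C₁ C₂ k * μ₂ *
          (min (V (i + 1) (k + 1)) (V (i + 1) k) - min (V i (k + 1)) (V i k)) := by
  have a := hV.step i k hk
  have b := hV.step (i + 1) k hk
  push_cast at b
  linear_combination b - a

theorem delta_low (C₁ C₂ : ℕ) (hC₂ : 1 ≤ C₂) (hC : C₂ < C₁) (μ₁ μ₂ h₀ h₁ h₂ : ℝ)
    (hμ₁ : 0 < μ₁) (hμ₂ : 0 < μ₂) (hh₀ : 0 < h₀) (hh₂ : 0 < h₂) (V : ℕ → ℕ → ℝ)
    (hV : Core C₁ C₂ μ₁ μ₂ h₀ h₁ h₂ V) (hcost : h₂ / μ₂ < h₁ / μ₁) :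
    ∀ i k, k ≤ C₁ → h₂ / μ₂ ≤ V (i + 1) k - V i k := by
  intro i
  induction i with
  | zero =>
    intro k hk
    have hd := dpos C₁ C₂ hC₂ hC μ₁ μ₂ hμ₁ hμ₂ k
    have hb := delta_base C₁ C₂ hC₂ μ₁ μ₂ h₀ h₁ h₂ hμ₁ hμ₂ V hV k hk
    have a1 : (k : ℝ) * μ₁ * (h₂ / μ₂) ≤
        (k : ℝ) * μ₁ * min (h₁ / μ₁) (sStep C₂ μ₂ h₂ (C₁ - (k - 1))) := by
      apply mul_le_mul_of_nonneg_left _ (by positivity)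
      exact le_min hcost.le (sStep_ge C₂ hC₂ μ₂ h₂ hμ₂ hh₂ _ (by omega))
    have a2 : eRate C₁ C₂ k * μ₂ * (h₂ / μ₂) ≤
        eRate C₁ C₂ k * μ₂ * min (h₁ / μ₁) (sStep C₂ μ₂ h₂ (C₁ - k)) := by
      rcases Nat.lt_or_ge k C₁ with h | h
      · apply mul_le_mul_of_nonneg_left _ (mul_nonneg (eRate_nonneg _ _ _) hμ₂.le)
        exact le_min hcost.le (sStep_ge C₂ hC₂ μ₂ h₂ hμ₂ hh₂ _ (by omega))
      · obtain rfl : k = C₁ := by omega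
        rw [eRate_top]; simp
    refine le_of_mul_le_mul_left ?_ hd
    rw [hb]
    linarith
  | succ i ih =>
    intro k hk
    have hd := dpos C₁ C₂ hC₂ hC μ₁ μ₂ hμ₁ hμ₂ k
    have hb := delta_step C₁ C₂ μ₁ μ₂ h₀ h₁ h₂ V hV i k hk
    have a1 : (k : ℝ) * μ₁ * (h₂ / μ₂) ≤ (k : ℝ) * μ₁ *
        (min (V (i + 1) k) (V (i + 1) (k - 1)) - min (V i k) (V i (k - 1))) := by
      apply mul_le_mul_of_nonneg_left _ (by positivity)
      exact min_sub_ge _ _ _ _ _ (ih k hk) (ih (k - 1) (by omega))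
    have a2 : eRate C₁ C₂ k * μ₂ * (h₂ / μ₂) ≤ eRate C₁ C₂ k * μ₂ *
        (min (V (i + 1) (k + 1)) (V (i + 1) k) - min (V i (k + 1)) (V i k)) := by
      rcases Nat.lt_or_ge k C₁ with h | h
      · apply mul_le_mul_of_nonneg_left _ (mul_nonneg (eRate_nonneg _ _ _) hμ₂.le)
        exact min_sub_ge _ _ _ _ _ (ih (k + 1) (by omega)) (ih k hk)
      · obtain rfl : k = C₁ := by omega
        rw [eRate_top]; simp
    refine le_of_mul_le_mul_left ?_ hd
    rw [hb]
    linarith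

/-- The linear marginal cost of the policy that always selects class two. -/
noncomputable def gLin (κ p h₀ x k : ℝ) : ℝ := κ + h₀ * (x - k) / p

theorem gLin_mul (κ p h₀ x k : ℝ) (hp : 0 < p) :
    p * gLin κ p h₀ x k = p * κ + h₀ * (x - k) := by
  unfold gLin; field_simp

theorem gLin_mono (κ p h₀ x k y l : ℝ) (hp : 0 < p) (hh₀ : 0 < h₀) (h : x - k ≤ y - l) :
    gLin κ p h₀ x k ≤ gLin κ p h₀ y l := by
  unfold gLin; gcongr

theorem delta_up (C₁ C₂ : ℕ) (hC₂ : 1 ≤ C₂) (hC : C₂ < C₁) (μ₁ μ₂ h₀ h₁ h₂ : ℝ)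
    (hμ₁ : 0 < μ₁) (hμ₂ : 0 < μ₂) (hh₀ : 0 < h₀) (hh₂ : 0 < h₂) (V : ℕ → ℕ → ℝ)
    (hV : Core C₁ C₂ μ₁ μ₂ h₀ h₁ h₂ V) (hμ : μ₂ ≤ μ₁) (hh : h₀ ≤ h₂) :
    ∀ i k, k ≤ C₁ → V (i + 1) k - V i k ≤
      gLin ((C₁ : ℝ) * h₂ / (C₂ * μ₂)) (C₂ * μ₂) h₀ ((i : ℝ) + 1) ((min k (C₁ - C₂) : ℕ) : ℝ) := by
  have hc2 : (0 : ℝ) < C₂ := by exact_mod_cast hC₂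
  have hcc : (C₂ : ℝ) < C₁ := by exact_mod_cast hC
  have hp : 0 < (C₂ : ℝ) * μ₂ := by positivity
  have hκ : ((C₂ : ℝ) * μ₂) * ((C₁ : ℝ) * h₂ / (C₂ * μ₂)) = C₁ * h₂ := by field_simp
  set p : ℝ := (C₂ : ℝ) * μ₂ with hpdef
  set κ : ℝ := (C₁ : ℝ) * h₂ / p with hκdef
  -- bound for the initial steps
  have hs : ∀ k, k < C₁ → sStep C₂ μ₂ h₂ (C₁ - k) ≤
      gLin κ p h₀ 0 ((min k (C₁ - C₂) : ℕ) : ℝ) := by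
    intro k hk
    have hm := gLin_mul κ p h₀ 0 ((min k (C₁ - C₂) : ℕ) : ℝ) hp
    refine le_of_mul_le_mul_left ?_ hp
    rw [hm, hκ]
    rcases Nat.le_total (k + C₂) C₁ with h | h
    · rw [sStep_hi _ _ _ _ (by omega), min_eq_left (by omega), Nat.cast_sub hk.le]
      have : p * (((C₁ : ℝ) - k) * h₂ / (C₂ * μ₂)) = ((C₁ : ℝ) - k) * h₂ := by
        rw [← hpdef]; field_simp
      rw [this]
      nlinarith [mul_le_mul_of_nonneg_left hh (Nat.cast_nonneg (α := ℝ) k)]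
    · rw [sStep_lo _ _ _ _ (by omega) (by omega), min_eq_right (by omega), Nat.cast_sub hC.le]
      have : p * (h₂ / μ₂) = C₂ * h₂ := by rw [hpdef]; field_simp
      rw [this]
      nlinarith [mul_le_mul_of_nonneg_left hh (sub_nonneg.2 hcc.le)]
  -- combination step
  have comb : ∀ (x : ℝ) (k : ℕ) (a b W : ℝ), k ≤ C₁ →
      (1 ≤ k → a ≤ gLin κ p h₀ x ((min (k - 1) (C₁ - C₂) : ℕ) : ℝ)) →
      (k < C₁ → b ≤ gLin κ p h₀ x ((min k (C₁ - C₂) : ℕ) : ℝ)) →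
      ((k : ℝ) * μ₁ + eRate C₁ C₂ k * μ₂) * W =
        h₀ + (k : ℝ) * μ₁ * a + eRate C₁ C₂ k * μ₂ * b →
      W ≤ gLin κ p h₀ (x + 1) ((min k (C₁ - C₂) : ℕ) : ℝ) := by
    intro x k a b W hk ha hb hW
    have hd := dpos C₁ C₂ hC₂ hC μ₁ μ₂ hμ₁ hμ₂ k
    refine le_of_mul_le_mul_left ?_ hd
    rw [hW]
    have hb' : eRate C₁ C₂ k * μ₂ * b ≤
        eRate C₁ C₂ k * μ₂ * gLin κ p h₀ x ((min k (C₁ - C₂) : ℕ) : ℝ) := by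
      rcases Nat.lt_or_ge k C₁ with h | h
      · exact mul_le_mul_of_nonneg_left (hb h) (mul_nonneg (eRate_nonneg _ _ _) hμ₂.le)
      · obtain rfl : k = C₁ := by omega
        rw [eRate_top]; simp
    have hg : ∀ y : ℝ, gLin κ p h₀ (x + 1) y = gLin κ p h₀ x y + h₀ / p := by
      intro y; unfold gLin; field_simp; ring
    rcases Nat.le_total (k + C₂) C₁ with h | h
    · have ha' : (k : ℝ) * μ₁ * a ≤ (k : ℝ) * μ₁ *
          gLin κ p h₀ (x + 1) ((min k (C₁ - C₂) : ℕ) : ℝ) := by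
        rcases Nat.eq_zero_or_pos k with h0 | h0
        · subst h0; simp
        · apply mul_le_mul_of_nonneg_left _ (by positivity)
          refine (ha h0).trans (gLin_mono _ _ _ _ _ _ _ hp hh₀ ?_)
          rw [min_eq_left (by omega), min_eq_left (by omega), Nat.cast_sub h0]
          push_cast; linarith
      rw [eRate_hi _ _ _ h] at hb' ⊢
      rw [hg] at ha' ⊢
      have : p * (h₀ / p) = h₀ := by field_simp
      rw [← hpdef] at hb' ⊢
      nlinarith
    · have ha' : (k : ℝ) * μ₁ * a ≤ (k : ℝ) * μ₁ *
          (gLin κ p h₀ x ((min k (C₁ - C₂) : ℕ) : ℝ) +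
            if k + C₂ = C₁ then h₀ / p else 0) := by
        apply mul_le_mul_of_nonneg_left _ (by positivity)
        refine (ha (by omega)).trans ?_
        split_ifs with hq
        · rw [← hg]
          apply gLin_mono _ _ _ _ _ _ _ hp hh₀
          rw [min_eq_left (by omega), min_eq_left (by omega), Nat.cast_sub (by omega)]
          push_cast; linarith
        · rw [min_eq_right (by omega), min_eq_right (by omega)]
          linarith
      have e0 : 0 < h₀ / p := by positivity
      have e1 : p * (h₀ / p) = h₀ := by field_simp
      rw [hg]
      split_ifs at ha' with hq
      · rw [eRate_hi _ _ _ hq.le, ← hpdef] at hb' ⊢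
        nlinarith
      · have hdp : p ≤ (k : ℝ) * μ₁ + eRate C₁ C₂ k * μ₂ := by
          rw [eRate_lo _ _ _ h hk, hpdef]
          have := mul_le_mul_of_nonneg_left hμ (Nat.cast_nonneg (α := ℝ) k)
          nlinarith
        have := mul_le_mul_of_nonneg_right hdp e0.le
        nlinarith
  intro i
  induction i with
  | zero =>
    intro k hk
    have hb := delta_base C₁ C₂ hC₂ μ₁ μ₂ h₀ h₁ h₂ hμ₁ hμ₂ V hV k hk
    have := comb 0 k _ _ _ hk (fun h => (min_le_right _ _).trans (hs (k - 1) (by omega)))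
      (fun h => (min_le_right _ _).trans (hs k h)) hb
    simpa using this
  | succ i ih =>
    intro k hk
    have hb := delta_step C₁ C₂ μ₁ μ₂ h₀ h₁ h₂ V hV i k hk
    have mono : ∀ a b : ℕ, a ≤ b → gLin κ p h₀ ((i : ℝ) + 1) ((min b (C₁ - C₂) : ℕ) : ℝ) ≤
        gLin κ p h₀ ((i : ℝ) + 1) ((min a (C₁ - C₂) : ℕ) : ℝ) := by
      intro a b hab
      apply gLin_mono _ _ _ _ _ _ _ hp hh₀
      have : ((min a (C₁ - C₂) : ℕ) : ℝ) ≤ ((min b (C₁ - C₂) : ℕ) : ℝ) := by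
        exact_mod_cast min_le_min_right _ hab
      linarith
    have := comb ((i : ℝ) + 1) k _ _ _ hk
      (fun h => min_sub_le _ _ _ _ _ ((ih k hk).trans (mono (k - 1) k (by omega)))
        (ih (k - 1) (by omega)))
      (fun h => min_sub_le _ _ _ _ _ ((ih (k + 1) (by omega)).trans (mono k (k + 1) (by omega)))
        (ih k hk)) hb
    simpa using this

/-- Nonnegativity of `D` when fewer than `C₂` slots are of class two. -/
theorem D_nonneg_low (C₁ C₂ : ℕ) (hC₂ : 1 ≤ C₂) (hC : C₂ < C₁) (μ₁ μ₂ h₀ h₁ h₂ : ℝ)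
    (hμ₁ : 0 < μ₁) (hμ₂ : 0 < μ₂) (V : ℕ → ℕ → ℝ)
    (hV : Core C₁ C₂ μ₁ μ₂ h₀ h₁ h₂ V) (hcost : h₂ / μ₂ < h₁ / μ₁) (N : ℕ)
    (hN : ∀ i j, i < N → C₁ ≤ j + C₂ → j < C₁ →
      (μ₁ - μ₂) * (V (i + 1) j - V i j) ≤ h₁ - h₂) :
    ∀ i j, i ≤ N → C₁ ≤ j + C₂ → j < C₁ → 0 ≤ V i (j + 1) - V i j := by
  intro i
  induction i with
  | zero =>
    intro j _ hj1 hj2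
    rw [hV.base j hj2, sStep_lo _ _ _ _ (by omega) (by omega)]
    linarith
  | succ i ih =>
    intro j hi hj1 hj2
    have hΔ := hN i j (by omega) hj1 hj2
    have hA := ih j (by omega) hj1 hj2
    have s1 := hV.step i (j + 1) (by omega)
    have s0 := hV.step i j (by omega)
    have hd := dpos C₁ C₂ hC₂ hC μ₁ μ₂ hμ₁ hμ₂ (j + 1)
    rw [eRate_lo _ _ _ (by omega) (by omega)] at s1 s0 hd
    simp only [Nat.add_sub_cancel] at s1
    have m1 : min (V i (j + 1)) (V i j) = V i j := min_eq_right (by linarith)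
    have m2 : min (V i j) (V i (j - 1)) ≤ V i j := min_le_left _ _
    have m3 : ((C₁ : ℝ) - (j + 1 : ℕ)) * μ₂ * V i j ≤
        ((C₁ : ℝ) - (j + 1 : ℕ)) * μ₂ * min (V i (j + 1 + 1)) (V i (j + 1)) := by
      rcases Nat.lt_or_ge (j + 1) C₁ with h | h
      · have := ih (j + 1) (by omega) (by omega) h
        have hc : (((j + 1 : ℕ)) : ℝ) < C₁ := by exact_mod_cast h
        apply mul_le_mul_of_nonneg_left _ (mul_nonneg (by linarith) hμ₂.le)
        exact le_min (by linarith) (by linarith)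
      · have : j + 1 = C₁ := by omega
        rw [this]; simp
    have m2' := mul_le_mul_of_nonneg_left m2 (mul_nonneg (Nat.cast_nonneg (α := ℝ) j) hμ₁.le)
    rw [m1] at s1 s0
    refine le_of_mul_le_mul_left ?_ hd
    push_cast at *
    nlinarith

theorem D_upper_s19 (C₁ C₂ : ℕ) (hC₂ : 1 ≤ C₂) (μ₁ μ₂ h₀ h₁ h₂ : ℝ)
    (hμ₁ : 0 < μ₁) (hμ₂ : 0 < μ₂) (hh₀ : 0 < h₀) (V : ℕ → ℕ → ℝ)
    (hV : Core C₁ C₂ μ₁ μ₂ h₀ h₁ h₂ V) (κ : ℝ) (hκ : C₂ * μ₂ * κ ≤ C₁ * h₂)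
    (hbase : ∀ j, j + 1 + C₂ ≤ C₁ → V 0 (j + 1) - V 0 j ≤
      (h₁ - h₂ + h₀) / μ₁ - gLin κ (C₂ * μ₂) h₀ 0 j) :
    ∀ i j : ℕ, j + 1 + C₂ ≤ C₁ → V i (j + 1) - V i j ≤
      max ((h₁ - h₂ + h₀) / μ₁ - gLin κ (C₂ * μ₂) h₀ i j) 0 := by
  have hc2 : (0 : ℝ) < C₂ := by exact_mod_cast hC₂
  have hp : 0 < (C₂ : ℝ) * μ₂ := by positivity
  have hK : μ₁ * ((h₁ - h₂ + h₀) / μ₁) = h₁ - h₂ + h₀ := by field_simp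
  set p : ℝ := (C₂ : ℝ) * μ₂ with hpdef
  set K : ℝ := (h₁ - h₂ + h₀) / μ₁ with hKdef
  intro i
  induction i with
  | zero =>
    intro j hj
    have := hbase j hj
    simp only [Nat.cast_zero]
    exact this.trans (le_max_left _ _)
  | succ i ih =>
    intro j hj
    have s1 := hV.step i (j + 1) (by omega)
    have s0 := hV.step i j (by omega)
    rw [eRate_hi _ _ _ (by omega), ← hpdef] at s1 s0
    simp only [Nat.add_sub_cancel] at s1
    have hGm := gLin_mul κ p h₀ ((i + 1 : ℕ) : ℝ) j hp
    have hG1 : gLin κ p h₀ ((i + 1 : ℕ) : ℝ) j = gLin κ p h₀ i j + h₀ / p := by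
      unfold gLin; push_cast; field_simp; ring
    have e1 : p * (h₀ / p) = h₀ := by field_simp
    have e0 : 0 < h₀ / p := by positivity
    set T : ℝ := K - gLin κ p h₀ ((i + 1 : ℕ) : ℝ) j with hT
    set t : ℝ := max T 0 with ht
    have ht0 : 0 ≤ t := le_max_right _ _
    have hTt : T ≤ t := le_max_left _ _
    set x : ℝ := (j : ℝ) * μ₁ with hx
    have hx0 : 0 ≤ x := by positivity
    have c1 : x * (min (V i (j + 1)) (V i j) - min (V i j) (V i (j - 1))) ≤ x * t := by
      rcases j with _ | j
      · simp [hx]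
      · apply mul_le_mul_of_nonneg_left _ hx0
        have h := ih j (by omega)
        have hg : gLin κ p h₀ (i : ℝ) (j : ℝ) = gLin κ p h₀ ((i + 1 : ℕ) : ℝ) ((j + 1 : ℕ) : ℝ) := by
          unfold gLin; push_cast; ring
        rw [hg, ← hT, ← ht] at h
        simp only [Nat.add_sub_cancel]
        have q1 := min_le_right (V i (j + 1 + 1)) (V i (j + 1))
        rcases min_cases (V i (j + 1)) (V i j) with q | q <;> linarith
    have c2 : p * (min (V i (j + 1 + 1)) (V i (j + 1)) - min (V i (j + 1)) (V i j)) ≤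
        p * (t + h₀ / p) := by
      apply mul_le_mul_of_nonneg_left _ hp.le
      have h := ih j hj
      have h' : max (K - gLin κ p h₀ i j) 0 ≤ t + h₀ / p := by
        apply max_le <;> linarith
      have q1 := min_le_right (V i (j + 1 + 1)) (V i (j + 1))
      rcases min_cases (V i (j + 1)) (V i j) with q | q <;> linarith
    have hxK : x * K = j * (h₁ - h₂ + h₀) := by rw [hx, mul_assoc, hK]
    -- marginal bound
    have hZ : K - t ≤ V (i + 1) j - min (V i (j + 1)) (V i j) := by
      have hd : 0 < x + p := by linarith
      refine le_of_mul_le_mul_left ?_ hd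
      have : p * (K - t) ≤ p * gLin κ p h₀ ((i + 1 : ℕ) : ℝ) j :=
        mul_le_mul_of_nonneg_left (by linarith) hp.le
      push_cast at *
      nlinarith
    have hZ' := mul_le_mul_of_nonneg_left hZ hμ₁.le
    have hd : 0 < x + μ₁ + p := by linarith
    refine le_of_mul_le_mul_left ?_ hd
    push_cast at *
    nlinarith

theorem D_lower_s19 (C₁ C₂ : ℕ) (hC₂ : 1 ≤ C₂) (μ₁ μ₂ h₀ h₁ h₂ : ℝ)
    (hμ₁ : 0 < μ₁) (hμ₂ : 0 < μ₂) (hh₀ : 0 < h₀) (V : ℕ → ℕ → ℝ)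
    (hV : Core C₁ C₂ μ₁ μ₂ h₀ h₁ h₂ V) (κ : ℝ) (hκ : C₂ * μ₂ * κ = C₁ * h₂)
    (hbase : ∀ j, j + 1 + C₂ ≤ C₁ → 
      (h₁ - h₂ + h₀) / μ₁ - gLin κ (C₂ * μ₂) h₀ 0 j ≤ V 0 (j + 1) - V 0 j)
    (hlow : ∀ i j : ℕ, j + C₂ = C₁ →
      0 < (h₁ - h₂ + h₀) / μ₁ - gLin κ (C₂ * μ₂) h₀ ((i : ℝ) + 2) j →
      0 ≤ V i (j + 1) - V i j) :
    ∀ i j : ℕ, j + 1 + C₂ ≤ C₁ →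
      0 < (h₁ - h₂ + h₀) / μ₁ - gLin κ (C₂ * μ₂) h₀ i j →
      (h₁ - h₂ + h₀) / μ₁ - gLin κ (C₂ * μ₂) h₀ i j ≤ V i (j + 1) - V i j := by
  have hc2 : (0 : ℝ) < C₂ := by exact_mod_cast hC₂
  have hp : 0 < (C₂ : ℝ) * μ₂ := by positivity
  have hK : μ₁ * ((h₁ - h₂ + h₀) / μ₁) = h₁ - h₂ + h₀ := by field_simp
  set p : ℝ := (C₂ : ℝ) * μ₂ with hpdef
  set K : ℝ := (h₁ - h₂ + h₀) / μ₁ with hKdef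
  intro i
  induction i with
  | zero =>
    intro j hj _
    simp only [Nat.cast_zero]
    exact hbase j hj
  | succ i ih =>
    intro j hj hpos
    have s1 := hV.step i (j + 1) (by omega)
    have s0 := hV.step i j (by omega)
    rw [eRate_hi _ _ _ (by omega), ← hpdef] at s1 s0
    simp only [Nat.add_sub_cancel] at s1
    have hGm := gLin_mul κ p h₀ ((i + 1 : ℕ) : ℝ) j hp
    have hG1 : gLin κ p h₀ ((i + 1 : ℕ) : ℝ) j = gLin κ p h₀ i j + h₀ / p := by
      unfold gLin; push_cast; field_simp; ring
    have e1 : p * (h₀ / p) = h₀ := by field_simp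
    have e0 : 0 < h₀ / p := by positivity
    set T : ℝ := K - gLin κ p h₀ ((i + 1 : ℕ) : ℝ) j with hT
    set x : ℝ := (j : ℝ) * μ₁ with hx
    have hx0 : 0 ≤ x := by positivity
    have hAB := ih j hj (by linarith)
    have hPA : 0 ≤ V i (j + 1 + 1) - V i (j + 1) := by
      rcases Nat.lt_or_ge (j + 1 + C₂) C₁ with h | h
      · have hm : gLin κ p h₀ i ((j + 1 : ℕ) : ℝ) ≤ gLin κ p h₀ ((i + 1 : ℕ) : ℝ) j := by
          apply gLin_mono _ _ _ _ _ _ _ hp hh₀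
          push_cast; linarith
        have := ih (j + 1) (by omega) (by linarith)
        linarith
      · apply hlow i (j + 1) (by omega)
        have hm : gLin κ p h₀ ((i : ℝ) + 2) ((j + 1 : ℕ) : ℝ) ≤ gLin κ p h₀ ((i + 1 : ℕ) : ℝ) j := by
          apply gLin_mono _ _ _ _ _ _ _ hp hh₀
          push_cast; linarith
        linarith
    have m1 : min (V i (j + 1)) (V i j) = V i j := min_eq_right (by linarith)
    have m3 : min (V i (j + 1 + 1)) (V i (j + 1)) = V i (j + 1) := min_eq_right (by linarith)
    rw [m1] at s1 s0
    rw [m3] at s1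
    have c1 : x * T ≤ x * (V i j - min (V i j) (V i (j - 1))) := by
      rcases j with _ | j
      · simp [hx]
      · apply mul_le_mul_of_nonneg_left _ hx0
        have hg : gLin κ p h₀ (i : ℝ) (j : ℝ) = gLin κ p h₀ ((i + 1 : ℕ) : ℝ) ((j + 1 : ℕ) : ℝ) := by
          unfold gLin; push_cast; ring
        have h := ih j (by omega) (by rw [hg]; exact hpos)
        rw [hg, ← hT] at h
        simp only [Nat.add_sub_cancel]
        have := min_le_right (V i (j + 1)) (V i j)
        linarith
    have c2 : p * (T + h₀ / p) ≤ p * (V i (j + 1) - V i j) :=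
      mul_le_mul_of_nonneg_left (by linarith) hp.le
    have hxK : x * K = j * (h₁ - h₂ + h₀) := by rw [hx, mul_assoc, hK]
    have hZ : V (i + 1) j - V i j ≤ K - T := by
      have hd : 0 < x + p := by linarith
      refine le_of_mul_le_mul_left ?_ hd
      have : p * (K - T) = p * gLin κ p h₀ ((i + 1 : ℕ) : ℝ) j := by rw [hT]; ring
      push_cast at *
      nlinarith
    have hZ' := mul_le_mul_of_nonneg_left hZ hμ₁.le
    have hd : 0 < x + μ₁ + p := by linarith
    refine le_of_mul_le_mul_left ?_ hd
    push_cast at *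
    nlinarith

theorem stmt19
    (C₁ C₂ : ℕ) (hC₂pos : 1 ≤ C₂) (hC : C₂ < C₁)
    (μ₁ μ₂ h₀ h₁ h₂ : ℝ)
    (hμ₁ : 0 < μ₁) (hμ₂ : 0 < μ₂)
    (hh₀ : 0 < h₀) (hh₁ : 0 < h₁) (hh₂ : 0 < h₂)
    (v : ℕ → ℕ → ℕ → ℝ) (hv : IsValue C₁ C₂ μ₁ μ₂ h₀ h₁ h₂ v)
    (hcost : h₂ / μ₂ < h₁ / μ₁)
    (k : ℕ) (hk1 : 1 ≤ k) (hkC : k ≤ C₁) (hℓ : C₂ ≤ C₁ - k)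
    (hcost2 : (((C₁ - k : ℕ) : ℝ) + 1) / (C₂ : ℝ) * (h₂ / μ₂) < h₁ / μ₁) :
    {i : ℕ | Dv v i k (C₁ - k) ≤ 0}.Nonempty ∧
    1 ≤ sInf {i : ℕ | Dv v i k (C₁ - k) ≤ 0} ∧
    (h₂ ≤ h₀ →
      ((sInf {i : ℕ | Dv v i k (C₁ - k) ≤ 0} : ℕ) : ℤ) ≤
        max ⌈((C₂ : ℝ) * (μ₂ / μ₁) * (h₁ - h₂) - (C₁ : ℝ) * h₂) / h₀
              + (((k : ℝ) - 1) + (C₂ : ℝ) * (μ₂ / μ₁))⌉ 0) ∧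
    (h₀ ≤ h₂ →
      max ⌈((C₂ : ℝ) * (μ₂ / μ₁) * (h₁ - h₂) - (C₁ : ℝ) * h₂) / h₀
              + (((k : ℝ) - 1) + (C₂ : ℝ) * (μ₂ / μ₁))⌉ 0 ≤
        ((sInf {i : ℕ | Dv v i k (C₁ - k) ≤ 0} : ℕ) : ℤ)) ∧
    (h₀ = h₂ →
      max ⌈((C₂ : ℝ) * (μ₂ / μ₁) * (h₁ - h₂) - (C₁ : ℝ) * h₂) / h₀
              + (((k : ℝ) - 1) + (C₂ : ℝ) * (μ₂ / μ₁))⌉ 0 =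
        ((sInf {i : ℕ | Dv v i k (C₁ - k) ≤ 0} : ℕ) : ℤ)) := by
  have hc2 : (0 : ℝ) < C₂ := by exact_mod_cast hC₂pos
  have hcc : (C₂ : ℝ) < C₁ := by exact_mod_cast hC
  have hp : 0 < (C₂ : ℝ) * μ₂ := by positivity
  obtain ⟨j, rfl⟩ : ∃ j, k = j + 1 := ⟨k - 1, by omega⟩
  have hj : j + 1 + C₂ ≤ C₁ := by omega
  set V : ℕ → ℕ → ℝ := fun i k => v i k (C₁ - k) with hVdef
  have hV : Core C₁ C₂ μ₁ μ₂ h₀ h₁ h₂ V :=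
    core_of_value C₁ C₂ hC₂pos hC μ₁ μ₂ h₀ h₁ h₂ hμ₁ hμ₂ v hv
  have hD : ∀ i, Dv v i (j + 1) (C₁ - (j + 1)) = V i (j + 1) - V i j := by
    intro i
    have : C₁ - (j + 1) + 1 = C₁ - j := by omega
    simp only [Dv, hVdef, Nat.add_sub_cancel, this]
  simp only [hD]
  have hbase : ∀ l, l + 1 + C₂ ≤ C₁ → V 0 (l + 1) - V 0 l =
      h₁ / μ₁ - ((C₁ : ℝ) - l) * h₂ / (C₂ * μ₂) := by
    intro l hl
    rw [hV.base l (by omega), sStep_hi _ _ _ _ (by omega), Nat.cast_sub (by omega)]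
  set K : ℝ := (h₁ - h₂ + h₀) / μ₁ with hKdef
  set p : ℝ := (C₂ : ℝ) * μ₂ with hpdef
  set κ : ℝ := (C₁ : ℝ) * h₂ / p with hκdef
  have hκ : p * κ = C₁ * h₂ := by rw [hκdef]; field_simp
  have hdiff : ∀ l : ℕ, K - gLin κ p h₀ 0 l - (h₁ / μ₁ - ((C₁ : ℝ) - l) * h₂ / p) =
      (h₀ - h₂) * (1 / μ₁ + l / p) := by
    intro l
    rw [hKdef, hκdef]; unfold gLin
    field_simp
    ring
  have hF : ∀ x : ℝ, K - gLin κ p h₀ x j ≤ 0 ↔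
      ((C₂ : ℝ) * (μ₂ / μ₁) * (h₁ - h₂) - (C₁ : ℝ) * h₂) / h₀
        + ((((j + 1 : ℕ) : ℝ) - 1) + (C₂ : ℝ) * (μ₂ / μ₁)) ≤ x := by
    intro x
    have : ((C₂ : ℝ) * (μ₂ / μ₁) * (h₁ - h₂) - (C₁ : ℝ) * h₂) / h₀
        + ((((j + 1 : ℕ) : ℝ) - 1) + (C₂ : ℝ) * (μ₂ / μ₁)) - x
        = (p / h₀) * (K - gLin κ p h₀ x j) := by
      rw [hKdef, hκdef]; unfold gLin
      rw [hpdef]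
      push_cast
      field_simp
      ring
    rw [← sub_nonpos (a := _ + _), this]
    have hq : 0 < p / h₀ := by positivity
    constructor
    · intro h; exact mul_nonpos_of_nonneg_of_nonpos hq.le h
    · intro h; by_contra hcon; push Not at hcon
      have := mul_pos hq hcon
      linarith
  have hne : {i : ℕ | V i (j + 1) - V i j ≤ 0}.Nonempty := by
    set κ' : ℝ := min κ (K - h₁ / μ₁) with hκ'
    have h1 : κ' ≤ κ := min_le_left _ _
    have h2 : κ' ≤ K - h₁ / μ₁ := min_le_right _ _
    have hup := D_upper_s19 C₁ C₂ hC₂pos μ₁ μ₂ h₀ h₁ h₂ hμ₁ hμ₂ hh₀ V hV κ'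
      (by rw [← hpdef, ← hκ]; exact mul_le_mul_of_nonneg_left h1 hp.le) (by
        intro l hl
        rw [hbase l hl, ← hpdef]
        have hl' : (l : ℝ) ≤ C₁ := by exact_mod_cast (by omega : l ≤ C₁)
        have a1 : 0 ≤ ((C₁ : ℝ) - l) * h₂ / p :=
          div_nonneg (mul_nonneg (by linarith) hh₂.le) hp.le
        have a2 : gLin κ' p h₀ 0 l ≤ κ' := by
          unfold gLin
          have : h₀ * (0 - (l : ℝ)) / p ≤ 0 := by
            apply div_nonpos_of_nonpos_of_nonneg _ hp.le
            have : (0 : ℝ) ≤ l := by positivity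
            nlinarith
          linarith
        linarith)
    obtain ⟨n, hn⟩ := exists_nat_ge (p * (K - κ') / h₀ + j)
    refine ⟨n, ?_⟩
    have := hup n j hj
    rw [max_eq_right] at this
    · exact this
    · rw [← hpdef]
      have hm := gLin_mul κ' p h₀ n j hp
      have h3 : p * (K - κ') / h₀ ≤ n - j := by linarith
      rw [div_le_iff₀ hh₀] at h3
      by_contra hcon; push Not at hcon
      have := mul_pos hp hcon
      nlinarith
  have hmem : V (sInf {i : ℕ | V i (j + 1) - V i j ≤ 0}) (j + 1)
      - V (sInf {i : ℕ | V i (j + 1) - V i j ≤ 0}) j ≤ 0 := Nat.sInf_mem hne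
  have hU : h₂ ≤ h₀ →
      ((sInf {i : ℕ | V i (j + 1) - V i j ≤ 0} : ℕ) : ℤ) ≤
        max ⌈((C₂ : ℝ) * (μ₂ / μ₁) * (h₁ - h₂) - (C₁ : ℝ) * h₂) / h₀
              + ((((j + 1 : ℕ) : ℝ) - 1) + (C₂ : ℝ) * (μ₂ / μ₁))⌉ 0 := by
    intro hh
    have hup := D_upper_s19 C₁ C₂ hC₂pos μ₁ μ₂ h₀ h₁ h₂ hμ₁ hμ₂ hh₀ V hV κ hκ.le (by
        intro l hl
        rw [hbase l hl, ← hpdef]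
        have := hdiff l
        have : 0 ≤ (h₀ - h₂) * (1 / μ₁ + l / p) := mul_nonneg (by linarith) (by positivity)
        linarith)
    set r : ℝ := ((C₂ : ℝ) * (μ₂ / μ₁) * (h₁ - h₂) - (C₁ : ℝ) * h₂) / h₀
              + ((((j + 1 : ℕ) : ℝ) - 1) + (C₂ : ℝ) * (μ₂ / μ₁)) with hr
    obtain ⟨n, hn⟩ := Int.eq_ofNat_of_zero_le (le_max_right ⌈r⌉ 0)
    rw [hn]
    have hle : r ≤ (n : ℝ) := by
      have h1 : ⌈r⌉ ≤ (n : ℤ) := by rw [← hn]; exact le_max_left _ _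
      have := Int.ceil_le.1 h1
      simpa using this
    have := hup n j hj
    rw [max_eq_right ((hF n).2 hle)] at this
    exact_mod_cast Nat.sInf_le this
  have hL : h₀ ≤ h₂ →
      max ⌈((C₂ : ℝ) * (μ₂ / μ₁) * (h₁ - h₂) - (C₁ : ℝ) * h₂) / h₀
              + ((((j + 1 : ℕ) : ℝ) - 1) + (C₂ : ℝ) * (μ₂ / μ₁))⌉ 0 ≤
        ((sInf {i : ℕ | V i (j + 1) - V i j ≤ 0} : ℕ) : ℤ) := by
    intro hh
    have hlow := D_lower_s19 C₁ C₂ hC₂pos μ₁ μ₂ h₀ h₁ h₂ hμ₁ hμ₂ hh₀ V hV κ hκ (by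
        intro l hl
        rw [hbase l hl, ← hpdef]
        have := hdiff l
        have : (h₀ - h₂) * (1 / μ₁ + l / p) ≤ 0 :=
          mul_nonpos_of_nonpos_of_nonneg (by linarith) (by positivity)
        linarith) (by
        intro i l hl hpos
        rw [← hpdef] at hpos
        rcases le_total μ₁ μ₂ with hμ | hμ
        · refine D_nonneg_low C₁ C₂ hC₂pos hC μ₁ μ₂ h₀ h₁ h₂ hμ₁ hμ₂ V hV hcost i ?_ i l
            le_rfl (by omega) (by omega)
          intro a b _ _ hb
          have hΔ := delta_low C₁ C₂ hC₂pos hC μ₁ μ₂ h₀ h₁ h₂ hμ₁ hμ₂ hh₀ hh₂ V hV hcost a b hb.le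
          have h1 := mul_le_mul_of_nonneg_left hΔ (sub_nonneg.2 hμ)
          have h2 : μ₂ * (h₂ / μ₂) = h₂ := by field_simp
          have h3 : μ₁ * (h₁ / μ₁) = h₁ := by field_simp
          have h4 := mul_le_mul_of_nonneg_left hcost.le hμ₁.le
          nlinarith
        · refine D_nonneg_low C₁ C₂ hC₂pos hC μ₁ μ₂ h₀ h₁ h₂ hμ₁ hμ₂ V hV hcost i ?_ i l
            le_rfl (by omega) (by omega)
          intro a b ha hb1 hb
          have hΔ := delta_up C₁ C₂ hC₂pos hC μ₁ μ₂ h₀ h₁ h₂ hμ₁ hμ₂ hh₀ hh₂ V hV hμ hh a b hb.le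
          rw [← hpdef, ← hκdef, min_eq_right (by omega), show C₁ - C₂ = l by omega] at hΔ
          have ha' : (a : ℝ) + 1 ≤ i := by exact_mod_cast ha
          have hm := gLin_mono κ p h₀ ((a : ℝ) + 1) l ((i : ℝ) + 2) l hp hh₀ (by linarith)
          have hΔK : V (a + 1) b - V a b ≤ K := by linarith
          have h1 := mul_le_mul_of_nonneg_left hΔK (sub_nonneg.2 hμ)
          have h3 : μ₁ * K = h₁ - h₂ + h₀ := by rw [hKdef]; field_simp
          have hl' : (l : ℝ) + C₂ = C₁ := by exact_mod_cast hl
          have hgm := gLin_mul κ p h₀ ((i : ℝ) + 2) l hp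
          have h4 : h₀ ≤ μ₂ * K := by
            have h5 : C₂ * h₀ ≤ C₂ * (μ₂ * K) := by
              have h6 := mul_pos hp hpos
              have h7 : 0 ≤ (C₁ : ℝ) * (h₂ - h₀) := mul_nonneg (by positivity) (by linarith)
              have h8 : 0 ≤ h₀ * ((i : ℝ) + 2) := by positivity
              have h9 : C₂ * (μ₂ * K) = p * K := by rw [hpdef]; ring
              rw [h9]
              have h10 : h₀ * (l : ℝ) + h₀ * C₂ = h₀ * C₁ := by rw [← hl']; ring
              nlinarith
            exact le_of_mul_le_mul_left h5 hc2
          nlinarith)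
    set s : ℕ := sInf {i : ℕ | V i (j + 1) - V i j ≤ 0} with hs
    apply max_le _ (by positivity)
    rw [Int.ceil_le]
    have : K - gLin κ p h₀ s j ≤ 0 := by
      by_contra hcon; push Not at hcon
      have := hlow s j hj hcon
      linarith
    simpa using (hF s).1 this
  refine ⟨hne, ?_, hU, hL, fun h => le_antisymm (hL h.le) (hU h.ge)⟩
  rw [Nat.one_le_iff_ne_zero]
  intro h0
  rw [h0, hbase j hj] at hmem
  have e : ((C₁ - (j + 1) : ℕ) : ℝ) + 1 = (C₁ : ℝ) - j := by
    rw [Nat.cast_sub (by omega)]; push_cast; ring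
  rw [e] at hcost2
  have e2 : ((C₁ : ℝ) - j) / C₂ * (h₂ / μ₂) = ((C₁ : ℝ) - j) * h₂ / p := by
    rw [hpdef]; field_simp
  linarith
end
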